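/- Let N be a positive integer such that log log(N/(log N)⁵) ≥ 10.4. Then N/log N < π(N) − ω(N) < 1.00005 · N/log N, where π(N) is the number of primes not exceeding N and ω(N) is the number of distinct prime divisors of N. -/

import Mathlib

section

open Complex Filter Topology Set

noncomputable def zE (n : ℕ) (s : ℂ) : ℂ :=
  (s - 1) * ((n : ℂ) + 1) ^ (-s) - ((n : ℂ) ^ (1 - s) - ((n : ℂ) + 1) ^ (1 - s))

lemma zE_norm {n : ℕ} (hn : 1 ≤ n) {s : ℂ} (hs : 0 < s.re) :
    ‖zE n s‖ ≤ ‖s‖ * ‖s - 1‖ / s.re * ((n : ℝ) ^ (-s.re) - ((n : ℝ) + 1) ^ (-s.re)) := by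
  have hn0 : (1 : ℝ) ≤ n := by exact_mod_cast hn
  set F : ℝ → ℂ := fun u => (s - 1) * ((u : ℂ) - n) * (u : ℂ) ^ (-s) + (u : ℂ) ^ (1 - s) - (n : ℂ) ^ (1 - s)
  set F' : ℝ → ℂ := fun u => -(s * (s - 1)) * ((u : ℂ) - n) * (u : ℂ) ^ (-s - 1)
  set B : ℝ → ℝ := fun u => ‖s‖ * ‖s - 1‖ / s.re * ((n : ℝ) ^ (-s.re) - u ^ (-s.re))
  set B' : ℝ → ℝ := fun u => ‖s‖ * ‖s - 1‖ * u ^ (-s.re - 1)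
  have hF : ∀ u : ℝ, 0 < u → HasDerivAt F (F' u) u := by
    intro u hu
    have hu' : (u : ℂ) ≠ 0 := by exact_mod_cast hu.ne'
    have hsl : (u : ℂ) ∈ slitPlane := by simp [hu]
    have h1 : HasDerivAt (fun z : ℂ => z ^ (-s)) ((-s) * (u : ℂ) ^ (-s - 1)) (u : ℂ) := by
      simpa using (hasDerivAt_id (u : ℂ)).cpow_const (c := -s) hsl
    have h2 : HasDerivAt (fun z : ℂ => z ^ (1 - s)) ((1 - s) * (u : ℂ) ^ (1 - s - 1)) (u : ℂ) := by
      simpa using (hasDerivAt_id (u : ℂ)).cpow_const (c := 1 - s) hsl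
    have h3 : HasDerivAt (fun z : ℂ => (s - 1) * (z - n)) (s - 1) (u : ℂ) := by
      simpa using ((hasDerivAt_id (u : ℂ)).sub_const (n : ℂ)).const_mul (s - 1)
    have h4 := (((h3.mul h1).add h2).sub_const ((n : ℂ) ^ (1 - s))).comp_ofReal
    refine h4.congr_deriv ?_
    have e1 : (u : ℂ) ^ (-s) = (u : ℂ) ^ (-s - 1) * u := by
      have := cpow_add (x := (u : ℂ)) (-s - 1) 1 hu'
      rw [cpow_one] at this
      rw [← this]; congr 1; ring
    have e2 : (1 - s - 1 : ℂ) = -s := by ring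
    rw [e2, e1]; simp only [F']; ring
  have hB : ∀ u : ℝ, 0 < u → HasDerivAt B (B' u) u := by
    intro u hu
    have := ((Real.hasDerivAt_rpow_const (p := -s.re) (Or.inl hu.ne')).const_sub ((n : ℝ) ^ (-s.re))).const_mul (‖s‖ * ‖s - 1‖ / s.re)
    refine this.congr_deriv ?_
    simp only [B']; field_simp
  have key := image_norm_le_of_norm_deriv_right_le_deriv_boundary' (f := F) (f' := F') (a := (n : ℝ)) (b := n + 1)
    (B := B) (B' := B')
    (fun u hu => (hF u (by linarith [hu.1])).continuousAt.continuousWithinAt)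
    (fun u hu => (hF u (by linarith [hu.1])).hasDerivWithinAt)
    (by simp [F, B])
    (fun u hu => (hB u (by linarith [hu.1])).continuousAt.continuousWithinAt)
    (fun u hu => (hB u (by linarith [hu.1])).hasDerivWithinAt)
    (fun u hu => by
      have hu0 : 0 < u := by linarith [hu.1]
      simp only [F', B', norm_mul, norm_neg]
      rw [norm_cpow_eq_rpow_re_of_pos hu0]
      have : ‖(u : ℂ) - n‖ ≤ 1 := by
        rw [← ofReal_natCast, ← ofReal_sub, norm_real, Real.norm_eq_abs, abs_le]
        constructor <;> linarith [hu.1, hu.2]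
      have e : (-s - 1).re = -s.re - 1 := by simp
      rw [e]
      have hp : 0 < u ^ (-s.re - 1) := Real.rpow_pos_of_pos hu0 _
      have : ‖s‖ * ‖s - 1‖ * ‖(u : ℂ) - n‖ ≤ ‖s‖ * ‖s - 1‖ := mul_le_of_le_one_right (by positivity) this
      gcongr)
  have := key (x := (n : ℝ) + 1) ⟨by linarith, le_rfl⟩
  have e : zE n s = F ((n : ℝ) + 1) := by simp only [zE, F]; push_cast; ring
  rw [e]; exact this

lemma rpow_neg_tendsto {σ : ℝ} (hs : 0 < σ) (N : ℕ) :
    Tendsto (fun k : ℕ => ((N + k : ℕ) : ℝ) ^ (-σ)) atTop (𝓝 0) := by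
  have h := (tendsto_rpow_neg_atTop hs).comp (tendsto_natCast_atTop_atTop (R := ℝ))
  exact h.comp (tendsto_atTop_mono (fun k => Nat.le_add_left k N) tendsto_id)

lemma tele_hasSum {σ : ℝ} (hs : 0 < σ) {N : ℕ} (hN : 1 ≤ N) :
    HasSum (fun k : ℕ => ((N + k : ℕ) : ℝ) ^ (-σ) - (((N + k : ℕ) : ℝ) + 1) ^ (-σ)) ((N : ℝ) ^ (-σ)) := by
  have h0 : ∀ k : ℕ, 0 ≤ ((N + k : ℕ) : ℝ) ^ (-σ) - (((N + k : ℕ) : ℝ) + 1) ^ (-σ) := by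
    intro k
    have h1 : (0 : ℝ) < ((N + k : ℕ) : ℝ) := by exact_mod_cast (by omega)
    have := Real.rpow_le_rpow_of_nonpos h1 (by linarith : ((N + k : ℕ) : ℝ) ≤ ((N + k : ℕ) : ℝ) + 1) (by linarith : -σ ≤ 0)
    linarith
  rw [hasSum_iff_tendsto_nat_of_nonneg h0]
  have : ∀ n, ∑ k ∈ Finset.range n, (((N + k : ℕ) : ℝ) ^ (-σ) - (((N + k : ℕ) : ℝ) + 1) ^ (-σ))
      = (N : ℝ) ^ (-σ) - ((N + n : ℕ) : ℝ) ^ (-σ) := by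
    intro n
    induction n with
    | zero => simp
    | succ n ih => rw [Finset.sum_range_succ, ih]; push_cast; rw [← add_assoc]; ring
  simp_rw [this]
  simpa using (rpow_neg_tendsto hs N).const_sub ((N : ℝ) ^ (-σ))

lemma zE_summable {s : ℂ} (hs : 0 < s.re) {N : ℕ} (hN : 1 ≤ N) : Summable (fun k => zE (N + k) s) :=
  Summable.of_norm_bounded ((tele_hasSum hs hN).summable.mul_left (‖s‖ * ‖s - 1‖ / s.re))
    (fun k => zE_norm (by omega) hs)

lemma zE_tsum_norm {s : ℂ} (hs : 0 < s.re) {N : ℕ} (hN : 1 ≤ N) :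
    ‖∑' k, zE (N + k) s‖ ≤ ‖s‖ * ‖s - 1‖ / s.re * (N : ℝ) ^ (-s.re) :=
  tsum_of_norm_bounded ((tele_hasSum hs hN).mul_left (‖s‖ * ‖s - 1‖ / s.re)) (fun k => zE_norm (by omega) hs)

lemma zE_tsum_differentiableOn {N : ℕ} (hN : 1 ≤ N) :
    DifferentiableOn ℂ (fun s => ∑' k, zE (N + k) s) {s | 0 < s.re} := by
  intro s hs
  have hs : 0 < s.re := hs
  set U : Set ℂ := {z | s.re / 2 < z.re} ∩ Metric.ball 0 (‖s‖ + 1)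
  have hU : IsOpen U := (isOpen_lt continuous_const continuous_re).inter Metric.isOpen_ball
  have hsU : s ∈ U := ⟨by simp; linarith, by simp⟩
  set e := s.re / 2
  have he : 0 < e := by simp [e]; linarith
  set C := (‖s‖ + 1) * (‖s‖ + 2)
  have hd : DifferentiableOn ℂ (fun z => ∑' k, zE (N + k) z) U := by
    apply differentiableOn_tsum_of_summable_norm (u := fun k : ℕ => C * ((k + 1 : ℕ) : ℝ) ^ (-e - 1))
    · apply Summable.mul_left
      exact (summable_nat_add_iff 1).mpr (Real.summable_nat_rpow.mpr (by linarith))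
    · intro k z _
      have h1 : ((N + k : ℕ) : ℂ) ≠ 0 := by exact_mod_cast (by omega)
      have h2 : ((N + k : ℕ) : ℂ) + 1 ≠ 0 := Nat.cast_add_one_ne_zero _
      apply DifferentiableAt.differentiableWithinAt
      unfold zE
      fun_prop (disch := first | exact Or.inl h1 | exact Or.inl h2 | exact h1 | exact h2)
    · exact hU
    · rintro k z ⟨hz1, hz2⟩
      have hz1 : e < z.re := hz1
      have hz2 : ‖z‖ < ‖s‖ + 1 := by simpa using hz2
      refine (zE_norm (by omega) (by linarith)).trans ?_
      have hm : (1 : ℝ) ≤ ((k + 1 : ℕ) : ℝ) := by simp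
      have hm2 : ((k + 1 : ℕ) : ℝ) ≤ ((N + k : ℕ) : ℝ) := by exact_mod_cast (by omega)
      set m : ℝ := ((N + k : ℕ) : ℝ)
      have hmp : 0 < m := by linarith
      -- mean value
      have mv : m ^ (-z.re) - (m + 1) ^ (-z.re) ≤ z.re * m ^ (-z.re - 1) := by
        have hc : ContinuousOn (fun x : ℝ => x ^ (-z.re)) (Icc m (m + 1)) := fun x hx =>
          (Real.continuousAt_rpow_const _ _ (Or.inl (by linarith [hx.1]))).continuousWithinAt
        obtain ⟨c, hc1, hc2⟩ := exists_hasDerivAt_eq_slope (fun x : ℝ => x ^ (-z.re))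
          (fun x => -z.re * x ^ (-z.re - 1)) (by linarith : m < m + 1) hc
          (fun x hx => Real.hasDerivAt_rpow_const (Or.inl (by linarith [hx.1])))
        have h5 : c ^ (-z.re - 1) ≤ m ^ (-z.re - 1) :=
          Real.rpow_le_rpow_of_nonpos hmp hc1.1.le (by linarith)
        simp only [add_sub_cancel_left, div_one] at hc2
        nlinarith
      have hz0 : 0 < z.re := by linarith
      calc ‖z‖ * ‖z - 1‖ / z.re * (m ^ (-z.re) - (m + 1) ^ (-z.re))
          ≤ ‖z‖ * ‖z - 1‖ / z.re * (z.re * m ^ (-z.re - 1)) := by gcongr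
        _ = ‖z‖ * ‖z - 1‖ * m ^ (-z.re - 1) := by field_simp
        _ ≤ C * ((k + 1 : ℕ) : ℝ) ^ (-e - 1) := by
          have : ‖z - 1‖ ≤ ‖s‖ + 2 := by
            calc _ ≤ ‖z‖ + ‖(1 : ℂ)‖ := norm_sub_le _ _
              _ ≤ _ := by simp; linarith
          have h3 : m ^ (-z.re - 1) ≤ ((k + 1 : ℕ) : ℝ) ^ (-e - 1) := by
            calc m ^ (-z.re - 1) ≤ ((k + 1 : ℕ) : ℝ) ^ (-z.re - 1) :=
                  Real.rpow_le_rpow_of_nonpos (by linarith) hm2 (by linarith)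
              _ ≤ _ := Real.rpow_le_rpow_of_exponent_le hm (by linarith)
          simp only [C]
          gcongr
  exact (hd.differentiableAt (hU.mem_nhds hsU)).differentiableWithinAt

lemma zeta1_eq_of_one_lt {N : ℕ} (hN : 1 ≤ N) {s : ℂ} (hs : 1 < s.re) :
    riemannZeta₁ s = (s - 1) * ∑ n ∈ Finset.range N, ((n : ℂ) + 1) ^ (-s) + (N : ℂ) ^ (1 - s) + ∑' k, zE (N + k) s := by
  have hs1 : s ≠ 1 := by rintro rfl; simp at hs
  have hz : riemannZeta₁ s = (s - 1) * riemannZeta s := by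
    rw [riemannZeta_eq_inv_sub_mul hs1, mul_inv_cancel_left₀ (sub_ne_zero.mpr hs1)]
  have hsum : Summable (fun n : ℕ => ((n : ℂ) + 1) ^ (-s)) := by
    have := (summable_nat_add_iff 1).mpr (Complex.summable_one_div_nat_cpow.mpr hs)
    refine this.congr (fun n => ?_)
    rw [cpow_neg]; simp
  have hzeta : riemannZeta s = ∑' n : ℕ, ((n : ℂ) + 1) ^ (-s) := by
    rw [zeta_eq_tsum_one_div_nat_add_one_cpow hs]
    congr 1; ext n; rw [cpow_neg]; simp
  have hshift : Summable (fun k : ℕ => ((N + k : ℕ) : ℂ) ^ (1 - s) - (((N + k : ℕ) : ℂ) + 1) ^ (1 - s)) := by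
    have h1 := zE_summable (s := s) (by linarith) hN
    have h2 := ((summable_nat_add_iff N).mpr hsum).mul_left (s - 1)
    refine (h2.sub h1).congr (fun k => ?_)
    simp only [zE]; push_cast; ring_nf
  have htel : ∑' k : ℕ, (((N + k : ℕ) : ℂ) ^ (1 - s) - (((N + k : ℕ) : ℂ) + 1) ^ (1 - s)) = (N : ℂ) ^ (1 - s) := by
    apply tendsto_nhds_unique hshift.hasSum.tendsto_sum_nat
    have : ∀ n, ∑ k ∈ Finset.range n, (((N + k : ℕ) : ℂ) ^ (1 - s) - (((N + k : ℕ) : ℂ) + 1) ^ (1 - s))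
      = (N : ℂ) ^ (1 - s) - ((N + n : ℕ) : ℂ) ^ (1 - s) := by
      intro n
      induction n with
      | zero => simp
      | succ n ih => rw [Finset.sum_range_succ, ih]; push_cast; rw [← add_assoc]; ring
    simp_rw [this]
    have hz : Tendsto (fun n : ℕ => ((N + n : ℕ) : ℂ) ^ (1 - s)) atTop (𝓝 0) := by
      rw [tendsto_zero_iff_norm_tendsto_zero]
      refine (rpow_neg_tendsto (σ := s.re - 1) (by linarith) N).congr (fun k => ?_)
      rw [norm_natCast_cpow_of_pos (by omega)]; simp
    simpa using hz.const_sub ((N : ℂ) ^ (1 - s))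
  rw [hz, hzeta, ← hsum.sum_add_tsum_nat_add N, mul_add, ← htel, add_assoc, add_left_cancel_iff,
    ← (hshift.tsum_add (zE_summable (by linarith) hN)), ← tsum_mul_left]
  congr 1; ext k; simp only [zE]; push_cast; ring_nf

lemma zeta1_eq {N : ℕ} (hN : 1 ≤ N) {s : ℂ} (hs : 0 < s.re) :
    riemannZeta₁ s = (s - 1) * ∑ n ∈ Finset.range N, ((n : ℂ) + 1) ^ (-s) + (N : ℂ) ^ (1 - s) + ∑' k, zE (N + k) s := by
  have hopen : IsOpen {s : ℂ | 0 < s.re} := isOpen_lt continuous_const continuous_re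
  have hN0 : (N : ℂ) ≠ 0 := by exact_mod_cast (by omega)
  have h1 : AnalyticOnNhd ℂ riemannZeta₁ {s : ℂ | 0 < s.re} :=
    differentiable_riemannZeta₁.differentiableOn.analyticOnNhd hopen
  have h2 : AnalyticOnNhd ℂ (fun s => (s - 1) * ∑ n ∈ Finset.range N, ((n : ℂ) + 1) ^ (-s) + (N : ℂ) ^ (1 - s) + ∑' k, zE (N + k) s) {s : ℂ | 0 < s.re} := by
    refine DifferentiableOn.analyticOnNhd ?_ hopen
    refine DifferentiableOn.add ?_ (zE_tsum_differentiableOn hN)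
    refine Differentiable.differentiableOn ?_
    have hn : ∀ n : ℕ, (n : ℂ) + 1 ≠ 0 := fun n => Nat.cast_add_one_ne_zero n
    refine Differentiable.add (Differentiable.mul (by fun_prop) ?_) ?_
    · refine Differentiable.fun_sum (fun n _ => ?_)
      intro z; exact (differentiableAt_id.neg).const_cpow (Or.inl (hn n))
    · intro z; exact ((differentiableAt_const _).sub differentiableAt_id).const_cpow (Or.inl hN0)
  have hconn : IsPreconnected {s : ℂ | 0 < s.re} := (convex_halfSpace_re_gt 0).isPreconnected
  refine h1.eqOn_of_preconnected_of_eventuallyEq h2 hconn (z₀ := 2) (by simp) ?_ hs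
  have : {s : ℂ | 1 < s.re} ∈ 𝓝 (2 : ℂ) := (isOpen_lt continuous_const continuous_re).mem_nhds (by simp)
  filter_upwards [this] with z hz
  exact zeta1_eq_of_one_lt hN hz

end

section

open Complex Filter Topology Set Metric

lemma zeta1_eq_mul {s : ℂ} (hs : s ≠ 1) : riemannZeta₁ s = (s - 1) * riemannZeta s := by
  rw [riemannZeta_eq_inv_sub_mul hs, mul_inv_cancel_left₀ (sub_ne_zero.mpr hs)]

lemma zeta1_sub_self {s : ℂ} (hs : 0 < s.re) : ‖riemannZeta₁ s - s‖ ≤ ‖s‖ * ‖s - 1‖ / s.re := by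
  have h := zeta1_eq (N := 1) le_rfl hs
  have h2 := zE_tsum_norm hs (N := 1) le_rfl
  have : riemannZeta₁ s - s = ∑' k, zE (1 + k) s := by rw [h]; simp
  rw [this]; simpa using h2

lemma zeta1_norm_le {s : ℂ} (hs : 0 < s.re) : ‖riemannZeta₁ s‖ ≤ ‖s‖ * (1 + ‖s - 1‖ / s.re) := by
  have h := zeta1_sub_self hs
  calc ‖riemannZeta₁ s‖ = ‖(riemannZeta₁ s - s) + s‖ := by ring_nf
    _ ≤ ‖riemannZeta₁ s - s‖ + ‖s‖ := norm_add_le _ _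
    _ ≤ ‖s‖ * ‖s - 1‖ / s.re + ‖s‖ := by gcongr
    _ = _ := by ring

lemma zeta1_ne_zero_near {s : ℂ} (hs : ‖s - 1‖ < s.re) : riemannZeta₁ s ≠ 0 := by
  intro h0
  have hp : 0 < s.re := (norm_nonneg _).trans_lt hs
  have h := zeta1_sub_self hp
  rw [h0, zero_sub, norm_neg] at h
  have hn : 0 < ‖s‖ := hp.trans_le (re_le_norm s)
  rw [mul_div_assoc] at h
  have : ‖s - 1‖ / s.re < 1 := by rwa [div_lt_one hp]
  nlinarith

lemma zeta1_ne_zero_of_one_le_re {s : ℂ} (hs : 1 ≤ s.re) : riemannZeta₁ s ≠ 0 := by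
  by_cases h : s = 1
  · rw [h, riemannZeta₁_one]; simp
  · rw [zeta1_eq_mul h]; exact mul_ne_zero (sub_ne_zero.mpr h) (riemannZeta_ne_zero_of_one_le_re hs)

lemma zeta_real_le {σ : ℝ} (hs : 1 < σ) : ‖riemannZeta σ‖ ≤ 2 + 1 / (σ - 1) := by
  have h1 : (σ : ℂ) ≠ 1 := by exact_mod_cast hs.ne'
  have h := zeta1_norm_le (s := σ) (by simp; linarith)
  have e : ‖(σ : ℂ) - 1‖ = σ - 1 := by
    rw [← ofReal_one, ← ofReal_sub, norm_real, Real.norm_of_nonneg (by linarith)]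
  rw [zeta1_eq_mul h1, norm_mul, e, norm_real, Real.norm_of_nonneg (by linarith), ofReal_re] at h
  have h2 : σ * (1 + (σ - 1) / σ) = 2 * σ - 1 := by field_simp; ring
  rw [h2] at h
  have h3 : 0 < σ - 1 := by linarith
  rw [show 2 + 1 / (σ - 1) = (2 * σ - 1) / (σ - 1) by field_simp; ring, le_div_iff₀ h3]
  linarith

open ArithmeticFunction in
lemma zeta_inv_norm_le {s : ℂ} (hs : 1 < s.re) : ‖riemannZeta s‖⁻¹ ≤ 2 + 1 / (s.re - 1) := by
  refine le_trans ?_ (zeta_real_le hs)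
  have h := LSeries_zeta_mul_Lseries_moebius hs
  rw [LSeries_zeta_eq_riemannZeta hs] at h
  have hz : (riemannZeta s)⁻¹ = LSeries (fun n => ((moebius n : ℤ) : ℂ)) s := inv_eq_of_mul_eq_one_right h
  rw [← norm_inv, hz]
  have hsum : Summable (fun n : ℕ => 1 / (n : ℝ) ^ s.re) := Real.summable_one_div_nat_rpow.mpr hs
  have hzr : riemannZeta (s.re : ℂ) = ((∑' n : ℕ, 1 / (n : ℝ) ^ s.re : ℝ) : ℂ) := by
    rw [zeta_eq_tsum_one_div_nat_cpow (by simpa using hs), ofReal_tsum]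
    congr 1; ext n
    push_cast
    rw [ofReal_cpow (by positivity)]; simp
  rw [hzr, norm_real]
  refine le_trans ?_ (le_abs_self _)
  refine tsum_of_norm_bounded hsum.hasSum (fun n => ?_)
  rw [LSeries.norm_term_eq]
  split_ifs with h0
  · positivity
  · gcongr
    rw [norm_intCast]
    exact_mod_cast abs_moebius_le_one

lemma neg_log_zeta_le {s : ℂ} (hs : 1 < s.re) : -Real.log ‖riemannZeta s‖ ≤ Real.log (2 + 1 / (s.re - 1)) := by
  rw [← Real.log_inv]
  exact Real.log_le_log (inv_pos.mpr (norm_pos_iff.mpr (riemannZeta_ne_zero_of_one_lt_re hs))) (zeta_inv_norm_le hs)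

lemma sum_rpow_le {α : ℝ} (h0 : 0 < α) (h1 : α ≤ 1) (N : ℕ) :
    ∑ n ∈ Finset.range N, ((n : ℝ) + 1) ^ (α - 1) ≤ (N : ℝ) ^ α / α := by
  induction N with
  | zero => simp [Real.zero_rpow h0.ne']
  | succ N ih =>
    rw [Finset.sum_range_succ]
    have key : ((N : ℝ) + 1) ^ (α - 1) ≤ ((N : ℝ) + 1) ^ α / α - (N : ℝ) ^ α / α := by
      have hc : ContinuousOn (fun x : ℝ => x ^ α) (Icc (N : ℝ) (N + 1)) :=
        (Real.continuous_rpow_const h0.le).continuousOn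
      obtain ⟨c, hc1, hc2⟩ := exists_hasDerivAt_eq_slope (fun x : ℝ => x ^ α)
          (fun x => α * x ^ (α - 1)) (by linarith : (N : ℝ) < N + 1) hc
          (fun x hx => Real.hasDerivAt_rpow_const (Or.inl (by
            have := hx.1; have : (0:ℝ) ≤ N := by positivity
            linarith)))
      have hcp : 0 < c := by
        have := hc1.1; have : (0:ℝ) ≤ N := by positivity
        linarith
      have h5 : ((N : ℝ) + 1) ^ (α - 1) ≤ c ^ (α - 1) :=
          Real.rpow_le_rpow_of_nonpos hcp hc1.2.le (by linarith)
      simp only [add_sub_cancel_left, div_one] at hc2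
      rw [← sub_div, le_div_iff₀ h0, ← hc2]
      nlinarith
    push_cast
    linarith

lemma zeta_upper {N : ℕ} (hN : 1 ≤ N) {α : ℝ} (h0 : 0 < α) (h1 : α ≤ 3/5) {s : ℂ} (hs : 1 - α ≤ s.re)
    (hsN : ‖s‖ ≤ N) (hs1 : 7/20 ≤ ‖s - 1‖) : ‖riemannZeta s‖ ≤ (N : ℝ) ^ α * (27/5 + 1 / α) := by
  have hre : 2/5 ≤ s.re := by linarith
  have hp : 0 < s.re := by linarith
  have hN1 : (1 : ℝ) ≤ N := by exact_mod_cast hN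
  have hN0 : (0 : ℝ) < N := by linarith
  have hne : s ≠ 1 := by rintro rfl; norm_num at hs1
  have h := zeta1_eq hN hp
  have hE := zE_tsum_norm hp hN
  rw [zeta1_eq_mul hne] at h
  set E := ∑' k, zE (N + k) s
  set S := ∑ n ∈ Finset.range N, ((n : ℂ) + 1) ^ (-s)
  have hs0 : s - 1 ≠ 0 := sub_ne_zero.mpr hne
  have hz : riemannZeta s = S + (N : ℂ) ^ (1 - s) / (s - 1) + E / (s - 1) := by
    have : riemannZeta s = ((s - 1) * riemannZeta s) / (s - 1) := by field_simp
    rw [this, h]; field_simp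
  have b1 : ‖S‖ ≤ (N : ℝ) ^ α / α := by
    refine (norm_sum_le _ _).trans (le_trans (Finset.sum_le_sum (fun n _ => ?_)) (sum_rpow_le h0 (by linarith) N))
    have : ((n : ℂ) + 1) = (((n : ℝ) + 1 : ℝ) : ℂ) := by push_cast; rfl
    rw [this, norm_cpow_eq_rpow_re_of_pos (by positivity)]
    apply Real.rpow_le_rpow_of_exponent_le
    · have : (0 : ℝ) ≤ n := by positivity
      linarith
    · simp; linarith
  have b2 : ‖(N : ℂ) ^ (1 - s) / (s - 1)‖ ≤ (N : ℝ) ^ α * (20/7) := by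
    rw [norm_div, norm_natCast_cpow_of_pos (by omega), div_eq_mul_inv]
    have : ‖s - 1‖⁻¹ ≤ 20/7 := by
      rw [inv_le_comm₀ (by linarith) (by norm_num)]; norm_num; linarith
    gcongr
    simp; linarith
  have b3 : ‖E / (s - 1)‖ ≤ (N : ℝ) ^ α * (5/2) := by
    rw [norm_div]
    have hn : 0 < ‖s - 1‖ := by linarith
    rw [div_le_iff₀ hn]
    refine hE.trans ?_
    have : ‖s‖ * ‖s - 1‖ / s.re * (N : ℝ) ^ (-s.re) ≤ N * ‖s - 1‖ / (2/5) * (N : ℝ) ^ (α - 1) := by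
      gcongr
      linarith
    refine this.trans (le_of_eq ?_)
    rw [Real.rpow_sub_one hN0.ne']; field_simp
  rw [hz]
  calc _ ≤ ‖S‖ + ‖(N : ℂ) ^ (1 - s) / (s - 1)‖ + ‖E / (s - 1)‖ := norm_add₃_le
    _ ≤ (N : ℝ) ^ α / α + (N : ℝ) ^ α * (20/7) + (N : ℝ) ^ α * (5/2) := by gcongr
    _ ≤ _ := by
      have : 0 < (N : ℝ) ^ α := by positivity
      have : (N : ℝ) ^ α / α = (N : ℝ) ^ α * (1 / α) := by ring
      nlinarith

lemma log_zeta_le {N : ℕ} (hN : 1 ≤ N) {α : ℝ} (h0 : 0 < α) (h1 : α ≤ 3/5) {s : ℂ} (hs : 1 - α ≤ s.re)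
    (hsN : ‖s‖ ≤ N) (hs1 : 7/20 ≤ ‖s - 1‖) : Real.log ‖riemannZeta s‖ ≤ α * Real.log N + Real.log (27/5 + 1 / α) := by
  have hN0 : (0 : ℝ) < N := by exact_mod_cast (by omega)
  by_cases hz : riemannZeta s = 0
  · rw [hz]; simp
    have : 0 ≤ Real.log N := Real.log_natCast_nonneg N
    have : 0 ≤ Real.log (27/5 + α⁻¹) := Real.log_nonneg (by
      have : 0 < α⁻¹ := by positivity
      linarith)
    positivity
  · rw [← Real.log_rpow hN0, ← Real.log_mul (by positivity) (by positivity)]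
    exact Real.log_le_log (norm_pos_iff.mpr hz) (zeta_upper hN h0 h1 hs hsN hs1)

open ArithmeticFunction in
lemma trig_ineq {σ : ℝ} (hs : 1 < σ) (γ : ℝ) :
    5 * (logDeriv riemannZeta σ).re + 8 * (logDeriv riemannZeta (σ + γ * I)).re + 4 * (logDeriv riemannZeta (σ + (2 * γ : ℝ) * I)).re
      + (logDeriv riemannZeta (σ + (3 * γ : ℝ) * I)).re ≤ 0 := by
  have key : ∀ t : ℝ, HasSum (fun n : ℕ => vonMangoldt n * (n : ℝ) ^ (-σ) * Real.cos (t * Real.log n)) (-(logDeriv riemannZeta (σ + t * I)).re) := by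
    intro t
    have hre : 1 < ((σ : ℂ) + t * I).re := by simpa using hs
    have h1 := (LSeriesSummable_vonMangoldt hre).hasSum
    have h2 := LSeries_vonMangoldt_eq_deriv_riemannZeta_div hre
    unfold LSeries at h2
    rw [h2] at h1
    have h3 := Complex.hasSum_re h1
    rw [neg_div, neg_re] at h3
    rw [logDeriv_apply]
    convert h3 using 1
    ext n
    by_cases hn : n = 0
    · subst hn; simp
    · rw [LSeries.term_of_ne_zero hn, div_eq_mul_inv, ← cpow_neg, re_ofReal_mul, mul_assoc]
      congr 1
      have hn0 : (0 : ℝ) < n := by exact_mod_cast Nat.pos_of_ne_zero hn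
      have hnC : (n : ℂ) ≠ 0 := by exact_mod_cast hn
      rw [cpow_def_of_ne_zero hnC, ← ofReal_natCast, ← ofReal_log hn0.le, exp_re, Real.rpow_def_of_pos hn0]
      simp only [mul_re, mul_im, ofReal_re, ofReal_im, neg_re, neg_im, add_re, add_im, I_re, I_im]
      rw [← Real.cos_neg (t * Real.log n)]
      congr 2 <;> ring
  have h0 := (key 0).mul_left 5
  have h1 := (key γ).mul_left 8
  have h2 := (key (2 * γ)).mul_left 4
  have h3 := key (3 * γ)
  have hall := ((h0.add h1).add h2).add h3
  have := hall.nonneg (fun n => by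
    set x := γ * Real.log n
    have e2 : Real.cos (2 * γ * Real.log n) = 2 * Real.cos x ^ 2 - 1 := by rw [← Real.cos_two_mul]; congr 1; simp only [x]; ring
    have e3 : Real.cos (3 * γ * Real.log n) = 4 * Real.cos x ^ 3 - 3 * Real.cos x := by rw [← Real.cos_three_mul]; congr 1; simp only [x]; ring
    rw [e2, e3, zero_mul, Real.cos_zero]
    have hw : 0 ≤ vonMangoldt n * (n : ℝ) ^ (-σ) := mul_nonneg vonMangoldt_nonneg (by positivity)
    have hc := Real.neg_one_le_cos x
    have : 0 ≤ (1 + Real.cos x) * (1 + 2 * Real.cos x) ^ 2 := mul_nonneg (by linarith) (sq_nonneg _)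
    have := mul_nonneg hw this
    nlinarith)
  simp only [ofReal_zero, zero_mul, add_zero] at this
  linarith

lemma logDeriv_zeta {s : ℂ} (hs : s ≠ 1) (hz : riemannZeta₁ s ≠ 0) :
    logDeriv riemannZeta s = logDeriv riemannZeta₁ s - 1 / (s - 1) := by
  have hs0 : s - 1 ≠ 0 := sub_ne_zero.mpr hs
  have e : riemannZeta =ᶠ[𝓝 s] fun z => (z - 1)⁻¹ * riemannZeta₁ z := by
    filter_upwards [isOpen_ne.mem_nhds hs] with z hz
    exact riemannZeta_eq_inv_sub_mul hz
  have h1 : logDeriv riemannZeta s = logDeriv (fun z => (z - 1)⁻¹ * riemannZeta₁ z) s := by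
    rw [logDeriv_apply, logDeriv_apply, e.deriv_eq, e.eq_of_nhds]
  have hd : HasDerivAt (fun z : ℂ => (z - 1)⁻¹) (-1 / (s - 1) ^ 2) s := by
    exact ((hasDerivAt_id s).sub_const 1).inv hs0
  rw [h1, logDeriv_mul (f := fun z : ℂ => (z - 1)⁻¹) s (inv_ne_zero hs0) hz hd.differentiableAt differentiable_riemannZeta₁.differentiableAt,
    logDeriv_apply, hd.deriv]
  field_simp; ring

lemma zeta_real_logDeriv {u : ℝ} (h0 : 0 < u) (h1 : u ≤ 3/200) :
    -(logDeriv riemannZeta ((1 + u : ℝ) : ℂ)).re ≤ 1 / u + 3 := by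
  set σ : ℂ := ((1 + u : ℝ) : ℂ) with hσ
  have hσ1 : σ - 1 = (u : ℂ) := by simp [hσ]
  have hσn1 : ‖σ - 1‖ = u := by rw [hσ1, norm_real, Real.norm_of_nonneg h0.le]
  have hne : σ ≠ 1 := by
    intro h; rw [h] at hσn1; simp at hσn1; linarith
  have hz : riemannZeta₁ σ ≠ 0 := zeta1_ne_zero_of_one_le_re (by simp [hσ]; linarith)
  have hb : ∀ s : ℂ, ‖s - 1‖ ≤ 1/8 → ‖riemannZeta₁ s - 1‖ ≤ ‖s - 1‖ * (16/7) := by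
    intro s hs
    have hre : 7/8 ≤ s.re := by
      have := (abs_re_le_norm (s - 1)).trans hs
      rw [sub_re, one_re, abs_le] at this; linarith [this.1]
    have hn : ‖s‖ ≤ 9/8 := by
      calc ‖s‖ = ‖(s - 1) + 1‖ := by ring_nf
        _ ≤ ‖s - 1‖ + ‖(1:ℂ)‖ := norm_add_le _ _
        _ ≤ _ := by rw [norm_one]; linarith
    have h := zeta1_sub_self (s := s) (by linarith)
    have h2 : ‖s‖ * ‖s - 1‖ / s.re ≤ (9/8) * ‖s - 1‖ / (7/8) := by gcongr
    calc ‖riemannZeta₁ s - 1‖ = ‖(riemannZeta₁ s - s) + (s - 1)‖ := by ring_nf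
      _ ≤ _ := norm_add_le _ _
      _ ≤ (9/8) * ‖s - 1‖ / (7/8) + ‖s - 1‖ := by gcongr; exact h.trans h2
      _ = _ := by ring
  have hder : ‖deriv (fun s => riemannZeta₁ s - 1) σ‖ ≤ (2/7) / (11/100) := by
    apply norm_deriv_le_of_forall_mem_sphere_norm_le (by norm_num)
    · exact (differentiable_riemannZeta₁.sub_const 1).diffContOnCl
    · intro z hz
      have hz1 : ‖z - 1‖ ≤ 1/8 := by
        rw [mem_sphere_iff_norm] at hz
        calc ‖z - 1‖ = ‖(z - σ) + (σ - 1)‖ := by ring_nf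
          _ ≤ ‖z - σ‖ + ‖σ - 1‖ := norm_add_le _ _
          _ ≤ _ := by rw [hz, hσn1]; linarith
      have := hb z hz1
      linarith
  rw [deriv_sub_const] at hder
  have hlow : 96/100 ≤ ‖riemannZeta₁ σ‖ := by
    have h2 := hb σ (by rw [hσn1]; linarith)
    rw [hσn1] at h2
    have h3 : ‖(1:ℂ)‖ ≤ ‖riemannZeta₁ σ - 1‖ + ‖riemannZeta₁ σ‖ := by
      calc ‖(1:ℂ)‖ = ‖riemannZeta₁ σ - (riemannZeta₁ σ - 1)‖ := by ring_nf
        _ ≤ _ := by rw [add_comm]; exact norm_sub_le _ _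
    rw [norm_one] at h3
    linarith
  rw [logDeriv_zeta hne hz, hσ1, sub_re]
  have e1 : (1 / (u : ℂ)).re = 1 / u := by rw [← ofReal_one, ← ofReal_div, ofReal_re]
  have h4 : ‖logDeriv riemannZeta₁ σ‖ ≤ 3 := by
    rw [logDeriv_apply, norm_div, div_le_iff₀ (by linarith)]
    linarith
  have h5 := (abs_re_le_norm _).trans h4
  rw [e1]; linarith [(abs_le.mp h5).1]

end

section

open Complex Filter Topology Set Metric

lemma cos_mean {h : ℂ → ℂ} {r : ℝ} (hr : 0 < r) (hh : DifferentiableOn ℂ h (closedBall 0 r)) :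
    ∫ θ in (0:ℝ)..(2 * Real.pi), (h (circleMap 0 r θ)).re * Real.cos θ = Real.pi * r * (deriv h 0).re := by
  have h1 := hh.deriv_eq_smul_circleIntegral hr
  have h2 : ∮ z in C(0, r), h z = 0 :=
    circleIntegral_eq_zero_of_differentiable_on_off_countable hr.le (s := ∅) (by simp) hh.continuousOn
      (fun z hz => hh.differentiableAt (mem_of_superset (isOpen_ball.mem_nhds hz.1) ball_subset_closedBall))
  have hcont : Continuous (fun θ : ℝ => h (circleMap 0 r θ)) :=
    hh.continuousOn.comp_continuous (continuous_circleMap 0 r) (fun θ => by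
      have := circleMap_mem_sphere (0 : ℂ) hr.le θ
      exact sphere_subset_closedBall this)
  simp only [circleIntegral, deriv_circleMap, smul_eq_mul] at h1 h2
  have hr' : (r : ℂ) ≠ 0 := by exact_mod_cast hr.ne'
  have h1' : ∫ θ in (0:ℝ)..(2 * Real.pi), h (circleMap 0 r θ) * cexp (-(θ * I)) = 2 * Real.pi * r * deriv h 0 := by
    have e : ∀ θ : ℝ, circleMap 0 r θ * I * (1 / (circleMap 0 r θ - 0) ^ 2 * h (circleMap 0 r θ))
        = (I / r) * (h (circleMap 0 r θ) * cexp (-(θ * I))) := by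
      intro θ
      have : cexp (θ * I) ≠ 0 := exp_ne_zero _
      rw [Complex.exp_neg]
      simp only [circleMap, zero_add, sub_zero]
      field_simp
    simp_rw [e] at h1
    rw [intervalIntegral.integral_const_mul] at h1
    have hI := I_ne_zero
    rw [show ∫ θ in (0:ℝ)..(2 * Real.pi), h (circleMap 0 r θ) * cexp (-(θ * I)) = (r / I) * ((I / r) * ∫ θ in (0:ℝ)..(2 * Real.pi), h (circleMap 0 r θ) * cexp (-(θ * I))) by
      rw [← mul_assoc, show (r / I : ℂ) * (I / r) = 1 by field_simp, one_mul], h1]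
    field_simp
  have h2' : ∫ θ in (0:ℝ)..(2 * Real.pi), h (circleMap 0 r θ) * cexp (θ * I) = 0 := by
    have e : ∀ θ : ℝ, circleMap 0 r θ * I * h (circleMap 0 r θ)
        = (r * I) * (h (circleMap 0 r θ) * cexp (θ * I)) := by
      intro θ; simp only [circleMap, zero_add]; ring
    simp_rw [e] at h2
    rw [intervalIntegral.integral_const_mul] at h2
    simpa [hr', I_ne_zero] using h2
  have h3 : ∫ θ in (0:ℝ)..(2 * Real.pi), h (circleMap 0 r θ) * (Real.cos θ : ℂ) = Real.pi * r * deriv h 0 := by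
    have e : ∀ θ : ℝ, h (circleMap 0 r θ) * (Real.cos θ : ℂ)
        = (1 / 2 : ℂ) * (h (circleMap 0 r θ) * cexp (θ * I) + h (circleMap 0 r θ) * cexp (-(θ * I))) := by
      intro θ; rw [ofReal_cos, Complex.cos]; ring_nf
    simp_rw [e]
    rw [intervalIntegral.integral_const_mul, intervalIntegral.integral_add, h1', h2']
    · ring
    · exact (hcont.mul (by fun_prop)).intervalIntegrable _ _
    · exact (hcont.mul (by fun_prop)).intervalIntegrable _ _
  have h4 := congrArg Complex.re h3
  have h5 : (∫ θ in (0:ℝ)..(2 * Real.pi), h (circleMap 0 r θ) * (Real.cos θ : ℂ)).re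
      = ∫ θ in (0:ℝ)..(2 * Real.pi), (h (circleMap 0 r θ) * (Real.cos θ : ℂ)).re := by
    have := (Complex.reCLM.intervalIntegral_comp_comm (μ := MeasureTheory.volume) (a := 0) (b := 2 * Real.pi)
      (f := fun θ : ℝ => h (circleMap 0 r θ) * (Real.cos θ : ℂ)) ((hcont.mul (by fun_prop)).intervalIntegrable _ _))
    exact this.symm
  rw [h5] at h4
  simp only [re_mul_ofReal] at h4
  rw [h4, ← ofReal_mul, re_ofReal_mul]

/-- the Jensen functional -/
noncomputable def Jf (f : ℂ → ℂ) (r : ℝ) : ℝ :=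
  (∫ θ in (0:ℝ)..(2 * Real.pi), Real.log ‖f (circleMap 0 r θ)‖ * Real.cos θ) / (Real.pi * r)

lemma Jf_of_ne_zero {g : ℂ → ℂ} {r : ℝ} (hr : 0 < r) (hg : AnalyticOnNhd ℂ g (closedBall 0 r))
    (h0 : ∀ z ∈ closedBall 0 r, g z ≠ 0) : (logDeriv g 0).re = Jf g r := by
  have hU : IsOpen {z | AnalyticAt ℂ g z ∧ g z ≠ 0} := by
    rw [isOpen_iff_mem_nhds]
    rintro z ⟨hz1, hz2⟩
    filter_upwards [hz1.eventually_analyticAt, hz1.continuousAt.eventually_ne hz2] with w h1 h2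
    exact ⟨h1, h2⟩
  obtain ⟨δ, hδ, hsub⟩ := (isCompact_closedBall (0 : ℂ) r).exists_cthickening_subset_open hU (fun z hz => ⟨hg z hz, h0 z hz⟩)
  have hball : ∀ z ∈ ball (0 : ℂ) (r + δ), AnalyticAt ℂ g z ∧ g z ≠ 0 := by
    intro z hz
    apply hsub
    apply thickening_subset_cthickening
    rw [thickening_closedBall hδ hr.le]
    simpa [add_comm] using hz
  have hd : DifferentiableOn ℂ (logDeriv g) (ball 0 (r + δ)) := by
    intro z hz
    obtain ⟨h1, h2⟩ := hball z hz
    exact (h1.deriv.differentiableAt.div h1.differentiableAt h2).differentiableWithinAt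
  obtain ⟨h, hh0, hh⟩ := hd.isExactOn_ball.with_val_at 0 0
  have hexp : ∀ z ∈ ball (0 : ℂ) (r + δ), g z * cexp (-h z) = g 0 := by
    have hder : ∀ z ∈ ball (0 : ℂ) (r + δ), HasDerivAt (fun z => g z * cexp (-h z)) 0 z := by
      intro z hz
      obtain ⟨h1, h2⟩ := hball z hz
      have := h1.differentiableAt.hasDerivAt.mul (hh z hz).neg.cexp
      refine this.congr_deriv ?_
      rw [logDeriv_apply]; simp only [Pi.neg_apply]; field_simp; ring
    intro z hz
    have h0mem : (0 : ℂ) ∈ ball (0 : ℂ) (r + δ) := by simp; linarith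
    have := (convex_ball (0 : ℂ) (r + δ)).is_const_of_fderivWithin_eq_zero (𝕜 := ℂ) (f := fun z => g z * cexp (-h z))
      (fun z hz => (hder z hz).differentiableAt.differentiableWithinAt)
      (fun z hz => by
        rw [fderivWithin_of_isOpen isOpen_ball hz]
        have := (hder z hz).hasFDerivAt.fderiv
        rw [this]; ext; simp) hz h0mem
    simpa [hh0] using this
  have hK : closedBall (0 : ℂ) r ⊆ ball 0 (r + δ) := closedBall_subset_ball (by linarith)
  have hm := cos_mean hr (h := h) (fun z hz => (hh z (hK hz)).differentiableAt.differentiableWithinAt)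
  have h0m : (0 : ℂ) ∈ closedBall (0 : ℂ) r := by simp [hr.le]
  rw [(hh 0 (hK h0m)).deriv] at hm
  have hlog : ∀ θ : ℝ, Real.log ‖g (circleMap 0 r θ)‖ * Real.cos θ
      = (h (circleMap 0 r θ)).re * Real.cos θ + Real.log ‖g 0‖ * Real.cos θ := by
    intro θ
    have hz := hK (sphere_subset_closedBall (circleMap_mem_sphere (0 : ℂ) hr.le θ))
    have e := hexp _ hz
    have : ‖g 0‖ = ‖g (circleMap 0 r θ)‖ * Real.exp (-(h (circleMap 0 r θ)).re) := by
      rw [← e, norm_mul, norm_exp]; simp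
    rw [this, Real.log_mul (by simpa using (hball _ hz).2) (Real.exp_ne_zero _), Real.log_exp]; ring
  have hcont : Continuous (fun θ : ℝ => h (circleMap 0 r θ)) := by
    have : ContinuousOn h (ball 0 (r + δ)) := fun z hz => (hh z hz).continuousAt.continuousWithinAt
    exact this.comp_continuous (continuous_circleMap 0 r) (fun θ => 
      hK (sphere_subset_closedBall (circleMap_mem_sphere (0 : ℂ) hr.le θ)))
  unfold Jf
  simp_rw [hlog]
  rw [intervalIntegral.integral_add, hm, intervalIntegral.integral_const_mul, integral_cos]
  · have := Real.pi_pos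
    simp; field_simp
  · exact ((continuous_re.comp hcont).mul Real.continuous_cos).intervalIntegrable _ _
  · exact (continuous_const.mul Real.continuous_cos).intervalIntegrable _ _

/-- Blaschke factor -/
noncomputable def blk (r : ℝ) (a z : ℂ) : ℂ := r * (z - a) / (r ^ 2 - (starRingEnd ℂ) a * z)

lemma blk_den {r : ℝ} {a z : ℂ} (ha : ‖a‖ < r) (hz : ‖z‖ ≤ r) : (r : ℂ) ^ 2 - (starRingEnd ℂ) a * z ≠ 0 := by
  intro h
  have hr : 0 < r := (norm_nonneg a).trans_lt ha
  have h1 : ‖(r : ℂ) ^ 2‖ = ‖(starRingEnd ℂ) a * z‖ := by rw [sub_eq_zero.mp h]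
  rw [norm_mul, norm_pow, norm_real, Real.norm_of_nonneg hr.le, RCLike.norm_conj] at h1
  nlinarith [norm_nonneg z, norm_nonneg a]

lemma blk_norm {r : ℝ} {a : ℂ} (ha : ‖a‖ < r) (θ : ℝ) : ‖blk r a (circleMap 0 r θ)‖ = 1 := by
  have hr : 0 < r := (norm_nonneg a).trans_lt ha
  have h := norm_canonicalFactor_eval_circle_eq_one (w := a) (R := r) (z := circleMap 0 r θ) (by simpa using ha)
    (circleMap_mem_sphere _ hr.le _)
  rw [canonicalFactor_apply, norm_div] at h
  unfold blk
  rw [norm_div]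
  have : ‖(r : ℂ) * (circleMap 0 r θ - a)‖ ≠ 0 := by
    intro h'; rw [h'] at h; simp at h
  rw [div_eq_one_iff_eq this] at h
  rw [h, div_self this]

lemma factor_step {f : ℂ → ℂ} {r : ℝ} (hf : AnalyticOnNhd ℂ f (closedBall 0 r))
    (h0 : f 0 ≠ 0) {a : ℂ} (ha : ‖a‖ < r) (hfa : f a = 0) :
    ∃ (n : ℕ) (g : ℂ → ℂ), 1 ≤ n ∧ AnalyticOnNhd ℂ g (closedBall 0 r) ∧ g a ≠ 0 ∧
      ∀ z ∈ closedBall (0 : ℂ) r, f z = blk r a z ^ n * g z := by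
  have hr : 0 < r := (norm_nonneg a).trans_lt ha
  have hr' : (r : ℂ) ≠ 0 := by exact_mod_cast hr.ne'
  have haK : a ∈ closedBall (0 : ℂ) r := by simpa using ha.le
  obtain ⟨p, hp⟩ := hf a haK
  have hp0 : p ≠ 0 := by
    rintro rfl
    have : f =ᶠ[𝓝 a] 0 := hp.eventually_eq_zero
    have := hf.eqOn_zero_of_preconnected_of_eventuallyEq_zero (convex_closedBall _ _).isPreconnected haK this
    exact h0 (this (by simp [hr.le]))
  set q := (Function.swap dslope a)^[p.order] f with hq
  have hqa : q a ≠ 0 := hp.iterate_dslope_fslope_ne_zero hp0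
  have hfq : ∀ z, f z = (z - a) ^ p.order * q z := fun z => by
    simpa using hp.eq_pow_order_mul_iterate_dslope z
  have hqan : AnalyticOnNhd ℂ q (closedBall 0 r) := by
    intro z hz
    by_cases hza : z = a
    · rw [hza]; exact (hp.has_fpower_series_iterate_dslope_fslope p.order).analyticAt
    · have h1 : AnalyticAt ℂ (fun z => f z / (z - a) ^ p.order) z :=
        (hf z hz).div (by fun_prop) (pow_ne_zero _ (sub_ne_zero.mpr hza))
      refine h1.congr ?_
      filter_upwards [isOpen_ne.mem_nhds hza] with w hw
      rw [hfq w]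
      have := pow_ne_zero p.order (sub_ne_zero.mpr hw)
      field_simp
  refine ⟨p.order, fun z => (((r : ℂ) ^ 2 - (starRingEnd ℂ) a * z) / r) ^ p.order * q z, ?_, ?_, ?_, ?_⟩
  · rw [Nat.one_le_iff_ne_zero]
    intro h
    have := hfq a
    rw [h, hfa] at this
    simp at this; exact hqa this.symm
  · intro z hz
    exact AnalyticAt.mul (by fun_prop) (hqan z hz)
  · refine mul_ne_zero (pow_ne_zero _ (div_ne_zero (blk_den ha ha.le) hr')) hqa
  · intro z hz
    have := blk_den ha (z := z) (by simpa using hz)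
    rw [hfq z, ← mul_assoc, ← mul_pow]
    congr 2
    unfold blk
    rw [div_mul_div_comm, mul_comm ((r : ℂ) ^ 2 - _) (r : ℂ), mul_right_comm, mul_comm _ (z - a), mul_div_assoc, div_self (mul_ne_zero hr' this), mul_one]

lemma blk_logDeriv {r : ℝ} {a : ℂ} (ha : ‖a‖ < r) (ha0 : a ≠ 0) :
    logDeriv (blk r a) 0 = -1 / a + (starRingEnd ℂ) a / r ^ 2 := by
  have hr : 0 < r := (norm_nonneg a).trans_lt ha
  have hr' : (r : ℂ) ≠ 0 := by exact_mod_cast hr.ne'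
  have h1 : HasDerivAt (fun z : ℂ => (r : ℂ) * (z - a)) r 0 := by
    simpa using ((hasDerivAt_id (0 : ℂ)).sub_const a).const_mul (r : ℂ)
  have h2 : HasDerivAt (fun z : ℂ => (r : ℂ) ^ 2 - (starRingEnd ℂ) a * z) (-(starRingEnd ℂ) a) 0 := by
    simpa using ((hasDerivAt_id (0 : ℂ)).const_mul ((starRingEnd ℂ) a)).const_sub ((r : ℂ) ^ 2)
  have h3 := h1.div h2 (by simpa using hr')
  rw [logDeriv_apply]
  have : blk r a = ((fun z : ℂ => (r : ℂ) * (z - a)) / fun z : ℂ => (r : ℂ) ^ 2 - (starRingEnd ℂ) a * z) := rfl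
  rw [this, h3.deriv]
  simp; field_simp; ring

noncomputable def ctr (r : ℝ) (a : ℂ) : ℝ := (-1 / a + (starRingEnd ℂ) a / r ^ 2).re

lemma ctr_nonneg {r : ℝ} {a : ℂ} (ha : ‖a‖ < r) (ha0 : a.re < 0) : 0 ≤ ctr r a := by
  have hr : 0 < r := (norm_nonneg a).trans_lt ha
  have hn : 0 < ‖a‖ := norm_pos_iff.mpr (by rintro rfl; simp at ha0)
  have : ctr r a = -a.re * (1 / ‖a‖ ^ 2 - 1 / r ^ 2) := by
    unfold ctr
    rw [add_re, ← ofReal_pow, div_ofReal_re, conj_re, neg_div, neg_re, one_div, inv_re, normSq_eq_norm_sq]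
    ring
  rw [this]
  apply mul_nonneg (by linarith)
  rw [sub_nonneg]
  gcongr

lemma jensen_step {f g : ℂ → ℂ} {r : ℝ} {n : ℕ} {a : ℂ} (ha : ‖a‖ < r) (ha0 : a.re < 0) (hg : AnalyticOnNhd ℂ g (closedBall 0 r))
    (hg0 : g 0 ≠ 0) (hfg : ∀ z ∈ closedBall (0 : ℂ) r, f z = blk r a z ^ n * g z) :
    (logDeriv f 0).re - Jf f r = n * ctr r a + ((logDeriv g 0).re - Jf g r) := by
  have hr : 0 < r := (norm_nonneg a).trans_lt ha
  have hr' : (r : ℂ) ≠ 0 := by exact_mod_cast hr.ne'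
  have hane : a ≠ 0 := by rintro rfl; simp at ha0
  have hJ : Jf f r = Jf g r := by
    unfold Jf
    congr 2; ext θ
    rw [hfg _ (sphere_subset_closedBall (circleMap_mem_sphere (0 : ℂ) hr.le θ)), norm_mul, norm_pow, blk_norm ha, one_pow, one_mul]
  have hb0 : blk r a 0 ≠ 0 := by
    unfold blk
    refine div_ne_zero (mul_ne_zero hr' (by simpa using hane)) (blk_den ha (by simpa using hr.le))
  have hbd : DifferentiableAt ℂ (blk r a) 0 := by
    unfold blk
    refine DifferentiableAt.div (by fun_prop) (by fun_prop) (blk_den ha (by simpa using hr.le))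
  have hL : logDeriv f 0 = n * logDeriv (blk r a) 0 + logDeriv g 0 := by
    have e : f =ᶠ[𝓝 0] fun z => (blk r a z ^ n) * g z := by
      filter_upwards [ball_mem_nhds (0 : ℂ) hr] with z hz
      exact hfg z (ball_subset_closedBall hz)
    have : logDeriv f 0 = logDeriv (fun z => (blk r a z ^ n) * g z) 0 := by
      rw [logDeriv_apply, logDeriv_apply, e.deriv_eq, e.eq_of_nhds]
    rw [this, logDeriv_mul (f := fun z => blk r a z ^ n) (0 : ℂ) (pow_ne_zero n hb0) hg0 (hbd.fun_pow n) (hg 0 (by simp [hr.le])).differentiableAt]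
    congr 1
    exact logDeriv_fun_pow hbd n
  rw [hJ, hL, blk_logDeriv ha hane, add_re, ← ofReal_natCast, re_ofReal_mul]
  unfold ctr
  ring

lemma jensen_ge : ∀ (m : ℕ) (f : ℂ → ℂ) (r : ℝ), 0 < r → AnalyticOnNhd ℂ f (closedBall 0 r) →
    ({z ∈ closedBall (0 : ℂ) r | f z = 0}).Finite → ({z ∈ closedBall (0 : ℂ) r | f z = 0}).ncard = m → 
    (∀ z ∈ closedBall (0 : ℂ) r, f z = 0 → ‖z‖ < r ∧ z.re < 0) → Jf f r ≤ (logDeriv f 0).re := by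
  intro m
  induction m with
  | zero =>
    intro f r hr hf hfin hm hz
    rw [ncard_eq_zero hfin] at hm
    refine (Jf_of_ne_zero hr hf (fun z hzK h => ?_)).ge
    have : z ∈ {z ∈ closedBall (0 : ℂ) r | f z = 0} := ⟨hzK, h⟩
    rw [hm] at this; exact this
  | succ m ih =>
    intro f r hr hf hfin hm hz
    obtain ⟨a, ha⟩ := nonempty_of_ncard_ne_zero (by rw [hm]; omega : ({z ∈ closedBall (0 : ℂ) r | f z = 0}).ncard ≠ 0)
    have ha1 := hz a ha.1 ha.2
    have h0K : (0 : ℂ) ∈ closedBall (0 : ℂ) r := by simp [hr.le]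
    have hf0 : f 0 ≠ 0 := fun h => by simpa using (hz 0 h0K h).2
    obtain ⟨n, g, hn, hg, hga, hfg⟩ := factor_step hf hf0 ha1.1 ha.2
    have hzg : {z ∈ closedBall (0 : ℂ) r | g z = 0} = {z ∈ closedBall (0 : ℂ) r | f z = 0} \ {a} := by
      ext z
      simp only [mem_ofPred_eq, Set.mem_sdiff, mem_singleton_iff]
      constructor
      · rintro ⟨h1, h2⟩
        refine ⟨⟨h1, by rw [hfg z h1, h2, mul_zero]⟩, ?_⟩
        rintro rfl; exact hga h2
      · rintro ⟨⟨h1, h2⟩, h3⟩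
        refine ⟨h1, ?_⟩
        rw [hfg z h1, mul_eq_zero] at h2
        refine h2.resolve_left (pow_ne_zero _ ?_)
        unfold blk
        refine div_ne_zero (mul_ne_zero (by exact_mod_cast hr.ne') (sub_ne_zero.mpr h3)) (blk_den ha1.1 (by simpa using h1))
    have hg0 : g 0 ≠ 0 := fun h => hf0 (by rw [hfg 0 h0K, h, mul_zero])
    have h1 := ih g r hr hg (by rw [hzg]; exact hfin.sdiff) (by
      rw [hzg, ncard_sdiff_singleton_of_mem ha, hm]; rfl) (fun z hzK h => hz z hzK (by rw [hfg z hzK, h, mul_zero]))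
    have h2 := jensen_step ha1.1 ha1.2 hg hg0 hfg
    have h3 : 0 ≤ n * ctr r a := mul_nonneg (by positivity) (ctr_nonneg ha1.1 ha1.2)
    linarith

lemma jensen_ge_zero {f : ℂ → ℂ} {r : ℝ} (hr : 0 < r) (hf : AnalyticOnNhd ℂ f (closedBall 0 r)) 
    (hfin : ({z ∈ closedBall (0 : ℂ) r | f z = 0}).Finite)
    (hz : ∀ z ∈ closedBall (0 : ℂ) r, f z = 0 → ‖z‖ < r ∧ z.re < 0) {a : ℂ} (haK : ‖a‖ < r) (hfa : f a = 0) :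
    Jf f r + ctr r a ≤ (logDeriv f 0).re := by
  have haK' : a ∈ closedBall (0 : ℂ) r := by simpa using haK.le
  have ha1 := hz a haK' hfa
  have h0K : (0 : ℂ) ∈ closedBall (0 : ℂ) r := by simp [hr.le]
  have hf0 : f 0 ≠ 0 := fun h => by simpa using (hz 0 h0K h).2
  obtain ⟨n, g, hn, hg, hga, hfg⟩ := factor_step hf hf0 ha1.1 hfa
  have hg0 : g 0 ≠ 0 := fun h => hf0 (by rw [hfg 0 h0K, h, mul_zero])
  have h1 := jensen_ge _ g r hr hg (hfin.subset (fun z hz => ⟨hz.1, by rw [hfg z hz.1, hz.2, mul_zero]⟩)) rfl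
    (fun z hzK h => hz z hzK (by rw [hfg z hzK, h, mul_zero]))
  have h2 := jensen_step ha1.1 ha1.2 hg hg0 hfg
  have h3 := ctr_nonneg ha1.1 ha1.2
  have h4 : (1 : ℝ) ≤ n := by exact_mod_cast hn
  nlinarith

end

section

open Complex Filter Topology Set Metric

lemma c_log_bound {c K r v : ℝ} (hc0 : 0 ≤ c) (hc1 : c ≤ 1) (hK : 0 ≤ K) (hr : 0 < r)
    (hv : 0 < c → v ≤ Real.log (K + 1 / (r * c))) : c * v ≤ c * Real.log (K + 1 / r) + (1 - c) := by
  rcases hc0.eq_or_lt with h | h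
  · rw [← h]; simp
  · have h1 := hv h
    have hKr : 0 < K + 1 / r := by positivity
    have h2 : K + 1 / (r * c) ≤ (K + 1 / r) * c⁻¹ := by
      have : 1 ≤ c⁻¹ := by rw [one_le_inv₀ h]; exact hc1
      have e : 1 / (r * c) = 1 / r * c⁻¹ := by field_simp
      rw [e]; nlinarith
    have h3 : Real.log (K + 1 / (r * c)) ≤ Real.log (K + 1 / r) + Real.log c⁻¹ := by
      rw [← Real.log_mul hKr.ne' (by positivity)]
      exact Real.log_le_log (by positivity) h2
    have h4 : Real.log c⁻¹ ≤ c⁻¹ - 1 := Real.log_le_sub_one_of_pos (by positivity)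
    calc c * v ≤ c * (Real.log (K + 1 / r) + (c⁻¹ - 1)) := by gcongr; linarith
      _ = _ := by field_simp

lemma A_bound {N : ℕ} (hN : 1 ≤ N) {r σ τ : ℝ} (hr1 : 1/2 ≤ r) (hr2 : r ≤ 3/5) (hσ1 : 1 < σ) (hσ2 : σ ≤ 51/50)
    (hτ : 19/20 ≤ |τ|) (hτN : |τ| + 2 ≤ N) (hz : ∀ z ∈ sphere (0 : ℂ) r, riemannZeta (σ + τ * I + z) ≠ 0) :
    -Jf (fun z => riemannZeta (σ + τ * I + z)) r ≤ 1 / 2 * Real.log N + 29/5 := by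
  have hr : 0 < r := by linarith
  have hπ := Real.pi_pos
  set F : ℝ → ℝ := fun θ => -(Real.log ‖riemannZeta (σ + τ * I + circleMap 0 r θ)‖ * Real.cos θ) with hF
  have hlogN : 0 ≤ Real.log N := Real.log_natCast_nonneg N
  have hre : ∀ θ : ℝ, (σ + τ * I + circleMap 0 r θ : ℂ).re = σ + r * Real.cos θ := by
    intro θ; simp [circleMap, exp_ofReal_mul_I_re]
  have him : ∀ θ : ℝ, (σ + τ * I + circleMap 0 r θ : ℂ).im = τ + r * Real.sin θ := by
    intro θ; simp [circleMap, exp_ofReal_mul_I_im]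
  have him2 : ∀ θ : ℝ, 7/20 ≤ |τ + r * Real.sin θ| := by
    intro θ
    have h1 : |r * Real.sin θ| ≤ 3/5 := by
      rw [abs_mul, abs_of_pos hr]
      have := Real.abs_sin_le_one θ
      nlinarith [abs_nonneg (Real.sin θ)]
    have := abs_sub_abs_le_abs_sub τ (-(r * Real.sin θ))
    rw [abs_neg, sub_neg_eq_add] at this
    linarith
  have hs1 : ∀ θ : ℝ, 7/20 ≤ ‖(σ + τ * I + circleMap 0 r θ : ℂ) - 1‖ := by
    intro θ
    refine (him2 θ).trans ?_
    have := abs_im_le_norm ((σ + τ * I + circleMap 0 r θ : ℂ) - 1)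
    rwa [sub_im, him, one_im, sub_zero] at this
  have hsN : ∀ θ : ℝ, ‖(σ + τ * I + circleMap 0 r θ : ℂ)‖ ≤ N := by
    intro θ
    calc ‖(σ + τ * I + circleMap 0 r θ : ℂ)‖ ≤ ‖(σ : ℂ)‖ + ‖(τ * I : ℂ)‖ + ‖circleMap 0 r θ‖ := norm_add₃_le
      _ = σ + |τ| + r := by
        rw [norm_real, Real.norm_of_nonneg (by linarith), norm_mul, norm_I, mul_one, norm_real, Real.norm_eq_abs,
          norm_circleMap_zero, abs_of_pos hr]
      _ ≤ N := by linarith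
  have hcontF : Continuous F := by
    have h1 : Continuous (fun θ : ℝ => riemannZeta (σ + τ * I + circleMap 0 r θ)) := by
      rw [continuous_iff_continuousAt]
      intro θ
      have hne : (σ + τ * I + circleMap 0 r θ : ℂ) ≠ 1 := by
        intro h; have := hs1 θ; rw [h] at this; norm_num at this
      have h2 : ContinuousAt (fun θ : ℝ => (σ + τ * I + circleMap 0 r θ : ℂ)) θ := by fun_prop
      exact ContinuousAt.comp (f := fun θ : ℝ => (σ + τ * I + circleMap 0 r θ : ℂ)) (differentiableAt_riemannZeta hne).continuousAt h2
    exact ((h1.norm.log (fun θ => norm_ne_zero_iff.mpr (hz _ (circleMap_mem_sphere _ hr.le _)))).mul Real.continuous_cos).neg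
  have hper : Function.Periodic F (2 * Real.pi) := by
    intro θ; simp only [hF, periodic_circleMap 0 r θ, Real.cos_periodic θ]
  have hJ : -Jf (fun z => riemannZeta (σ + τ * I + z)) r = (∫ θ in (0:ℝ)..(2 * Real.pi), F θ) / (Real.pi * r) := by
    unfold Jf; simp only [hF]; rw [intervalIntegral.integral_neg]; ring
  have hsplit : ∫ θ in (0:ℝ)..(2 * Real.pi), F θ =
      (∫ θ in (-(Real.pi / 2))..(Real.pi / 2), F θ) + ∫ θ in (Real.pi / 2)..(Real.pi / 2 + Real.pi), F θ := by
    rw [intervalIntegral.integral_add_adjacent_intervals (hcontF.intervalIntegrable _ _) (hcontF.intervalIntegrable _ _)]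
    have := hper.intervalIntegral_add_eq 0 (-(Real.pi / 2))
    rw [zero_add] at this; rw [this]; congr 1; ring
  have hR : ∫ θ in (-(Real.pi / 2))..(Real.pi / 2), F θ ≤ 2 * Real.log (2 + 1 / r) + Real.pi - 2 := by
    have hle : ∫ θ in (-(Real.pi / 2))..(Real.pi / 2), F θ ≤
        ∫ θ in (-(Real.pi / 2))..(Real.pi / 2), (Real.cos θ * (Real.log (2 + 1 / r) - 1) + 1) := by
      apply intervalIntegral.integral_mono_on (by linarith) (hcontF.intervalIntegrable _ _)
        ((by fun_prop : Continuous fun θ => Real.cos θ * (Real.log (2 + 1 / r) - 1) + 1).intervalIntegrable _ _)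
      intro θ hθ
      have hc := Real.cos_nonneg_of_mem_Icc hθ
      have := c_log_bound (v := -Real.log ‖riemannZeta (σ + τ * I + circleMap 0 r θ)‖) hc (Real.cos_le_one θ) (K := 2) (by norm_num) hr (fun hp => by
        have h3 : r * Real.cos θ ≤ (σ + τ * I + circleMap 0 r θ : ℂ).re - 1 := by rw [hre]; linarith
        have h4 : 0 < r * Real.cos θ := by positivity
        refine (neg_log_zeta_le (s := σ + τ * I + circleMap 0 r θ) (by linarith)).trans ?_
        apply Real.log_le_log
        · have : 0 < (σ + τ * I + circleMap 0 r θ : ℂ).re - 1 := by linarith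
          positivity
        · gcongr)
      simp only [hF]
      linarith
    refine hle.trans (le_of_eq ?_)
    rw [intervalIntegral.integral_add ((by fun_prop : Continuous fun θ => Real.cos θ * (Real.log (2 + 1 / r) - 1)).intervalIntegrable _ _) (by simp),
      intervalIntegral.integral_mul_const, integral_cos]
    simp; ring
  have hL : ∫ θ in (Real.pi / 2)..(Real.pi / 2 + Real.pi), F θ ≤
      r * Real.log N * (Real.pi / 2) + 2 * Real.log (27/5 + 1 / r) + Real.pi - 2 := by
    have hle : ∫ θ in (Real.pi / 2)..(Real.pi / 2 + Real.pi), F θ ≤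
        ∫ θ in (Real.pi / 2)..(Real.pi / 2 + Real.pi), ((r * Real.log N) * Real.cos θ ^ 2 + (Real.cos θ * (1 - Real.log (27/5 + 1 / r)) + 1)) := by
      apply intervalIntegral.integral_mono_on (by linarith) (hcontF.intervalIntegrable _ _)
        ((by fun_prop : Continuous fun θ => ((r * Real.log N) * Real.cos θ ^ 2 + (Real.cos θ * (1 - Real.log (27/5 + 1 / r)) + 1))).intervalIntegrable _ _)
      intro θ hθ
      have hc : Real.cos θ ≤ 0 := Real.cos_nonpos_of_pi_div_two_le_of_le hθ.1 (by linarith [hθ.2])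
      have := c_log_bound (c := -Real.cos θ) (v := Real.log ‖riemannZeta (σ + τ * I + circleMap 0 r θ)‖ - (r * -Real.cos θ) * Real.log N)
        (by linarith) (by linarith [Real.neg_one_le_cos θ]) (K := 27/5) (by norm_num) hr (fun hp => by
        have h4 : 0 < r * -Real.cos θ := by positivity
        have := log_zeta_le hN h4 (by nlinarith [Real.neg_one_le_cos θ]) (s := σ + τ * I + circleMap 0 r θ) (by rw [hre]; linarith) (hsN θ) (hs1 θ)
        linarith)
      simp only [hF]
      nlinarith
    refine hle.trans (le_of_eq ?_)
    rw [intervalIntegral.integral_add ((by fun_prop : Continuous fun θ => (r * Real.log N) * Real.cos θ ^ 2).intervalIntegrable _ _)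
      ((by fun_prop : Continuous fun θ => Real.cos θ * (1 - Real.log (27/5 + 1 / r)) + 1).intervalIntegrable _ _),
      intervalIntegral.integral_add ((by fun_prop : Continuous fun θ => Real.cos θ * (1 - Real.log (27/5 + 1 / r))).intervalIntegrable _ _) (by simp),
      intervalIntegral.integral_mul_const, intervalIntegral.integral_const_mul, integral_cos, integral_cos_sq]
    simp [Real.sin_add, Real.cos_add]; ring
  rw [hJ, hsplit, div_le_iff₀ (by positivity)]
  have l1 : Real.log (2 + 1 / r) + Real.log (27/5 + 1 / r) ≤ 34/10 := by
    rw [← Real.log_mul (by positivity) (by positivity)]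
    have h1 : (2 + 1 / r) * (27/5 + 1 / r) ≤ 4 * (37/5) := by
      have : 1 / r ≤ 2 := by rw [div_le_iff₀ hr]; linarith
      have : 0 < 1 / r := by positivity
      nlinarith
    refine (Real.log_le_log (by positivity) h1).trans ?_
    have h2 : Real.log ((4 * (37/5)) ^ 10) ≤ Real.log (2 ^ 49) := Real.log_le_log (by norm_num) (by norm_num)
    rw [Real.log_pow, Real.log_pow] at h2
    have := Real.log_two_lt_d9
    push_cast at h2; linarith
  have hp3 := Real.pi_gt_d2
  nlinarith

lemma exists_radius (s0 : ℂ) : ∃ r : ℝ, 1/2 ≤ r ∧ r ≤ 3/5 ∧ ∀ z ∈ sphere (0 : ℂ) r, riemannZeta (s0 + z) ≠ 0 := by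
  have hfin := (isCompact_closedBall s0 (3/5)).inter_riemannZetaZeros_finite
  have hfin2 := hfin.image (fun z => ‖z - s0‖)
  obtain ⟨r, hr, hr2⟩ := ((Icc_infinite (by norm_num : (1/2 : ℝ) < 3/5)).sdiff hfin2).nonempty
  refine ⟨r, hr.1, hr.2, fun z hz h => hr2 ⟨s0 + z, ⟨?_, h⟩, ?_⟩⟩
  · simp at hz; simp [hz]; linarith [hr.2]
  · simpa using hz

lemma zeta_disc {s0 : ℂ} {r : ℝ} (hr : 0 < r) (hre : 1 ≤ s0.re) (h1 : r < |s0.im|) (hz : ∀ z ∈ sphere (0 : ℂ) r, riemannZeta (s0 + z) ≠ 0) :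
    AnalyticOnNhd ℂ (fun z => riemannZeta (s0 + z)) (closedBall 0 r) ∧ 
    ({z ∈ closedBall (0 : ℂ) r | riemannZeta (s0 + z) = 0}).Finite ∧
    (∀ z ∈ closedBall (0 : ℂ) r, riemannZeta (s0 + z) = 0 → ‖z‖ < r ∧ z.re < 0) := by
  refine ⟨?_, ?_, ?_⟩
  · have hopen : IsOpen {z : ℂ | s0 + z ≠ 1} := isOpen_ne.preimage (by fun_prop : Continuous fun z => s0 + z)
    have : DifferentiableOn ℂ (fun z => riemannZeta (s0 + z)) {z : ℂ | s0 + z ≠ 1} := by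
      intro z hz
      have hz : s0 + z ≠ 1 := hz
      exact ((differentiableAt_riemannZeta hz).comp z (by fun_prop)).differentiableWithinAt
    refine (this.analyticOnNhd hopen).mono ?_
    intro z hz h
    have h2 : z.im = - s0.im := by
      have := congrArg Complex.im h
      simp at this; linarith
    have h3 := abs_im_le_norm z
    rw [h2, abs_neg] at h3
    simp at hz; linarith
  · have hfin := (isCompact_closedBall s0 r).inter_riemannZetaZeros_finite
    refine (hfin.image (fun z => z - s0)).subset ?_
    rintro z ⟨hz1, hz2⟩
    refine ⟨s0 + z, ⟨?_, hz2⟩, by simp⟩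
    simp at hz1; simpa using hz1
  · intro z hz1 hz2
    constructor
    · simp at hz1
      refine lt_of_le_of_ne hz1 (fun h => hz z (by simpa using h) hz2)
    · by_contra! h
      exact riemannZeta_ne_zero_of_one_le_re (s := s0 + z) (by simp; linarith) hz2

lemma logDeriv_shift (s0 : ℂ) : logDeriv (fun z => riemannZeta (s0 + z)) 0 = logDeriv riemannZeta s0 := by
  rw [logDeriv_apply, logDeriv_apply, deriv_comp_const_add, add_zero]

lemma logDeriv_upper {N : ℕ} (hN : 1 ≤ N) {σ τ : ℝ} (hσ1 : 1 < σ) (hσ2 : σ ≤ 51/50)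
    (hτ : 19/20 ≤ |τ|) (hτN : |τ| + 2 ≤ N) :
    -(logDeriv riemannZeta (σ + τ * I)).re ≤ 1 / 2 * Real.log N + 29/5 := by
  obtain ⟨r, hr1, hr2, hz⟩ := exists_radius (σ + τ * I)
  have hr : 0 < r := by linarith
  obtain ⟨h1, h2, h3⟩ := zeta_disc hr (by simp; linarith) (by simp; linarith) hz
  have := jensen_ge _ _ r hr h1 h2 rfl h3
  rw [logDeriv_shift] at this
  linarith [A_bound hN hr1 hr2 hσ1 hσ2 hτ hτN hz]

lemma logDeriv_upper_zero {N : ℕ} (hN : 1 ≤ N) {σ τ β : ℝ} (hσ1 : 1 < σ) (hσ2 : σ ≤ 51/50)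
    (hτ : 19/20 ≤ |τ|) (hτN : |τ| + 2 ≤ N) (hβ : riemannZeta (β + τ * I) = 0) (hx : σ - β < 1/2) :
    -(logDeriv riemannZeta (σ + τ * I)).re ≤ 1 / 2 * Real.log N + 29/5 - (1 / (σ - β) - 4 * (σ - β)) := by
  obtain ⟨r, hr1, hr2, hz⟩ := exists_radius (σ + τ * I)
  have hr : 0 < r := by linarith
  obtain ⟨h1, h2, h3⟩ := zeta_disc hr (by simp; linarith) (by simp; linarith) hz
  have hβ1 : β < 1 := by
    by_contra! h
    exact riemannZeta_ne_zero_of_one_le_re (s := β + τ * I) (by simpa using h) hβ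
  have hx0 : 0 < σ - β := by linarith
  have ha : ‖((-(σ - β) : ℝ) : ℂ)‖ < r := by
    rw [norm_real, Real.norm_eq_abs, abs_neg, abs_of_pos hx0]; linarith
  have := jensen_ge_zero hr h1 h2 h3 (a := ((-(σ - β) : ℝ) : ℂ)) ha (by
    rw [← hβ]; congr 1; push_cast; ring)
  rw [logDeriv_shift] at this
  have hc : 1 / (σ - β) - 4 * (σ - β) ≤ ctr r ((-(σ - β) : ℝ) : ℂ) := by
    have e : ctr r ((-(σ - β) : ℝ) : ℂ) = 1 / (σ - β) - (σ - β) / r ^ 2 := by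
      unfold ctr
      rw [conj_ofReal, ← ofReal_one, ← ofReal_neg, ← ofReal_div, ← ofReal_pow, ← ofReal_div, ← ofReal_add, ofReal_re, neg_div_neg_eq, neg_div]
      ring
    rw [e]
    have : (σ - β) / r ^ 2 ≤ 4 * (σ - β) := by
      rw [div_le_iff₀ (by positivity)]
      have : 1/4 ≤ r ^ 2 := by nlinarith
      nlinarith
    linarith
  linarith [A_bound hN hr1 hr2 hσ1 hσ2 hτ hτN hz]

lemma zero_free {N : ℕ} (hN : 3 ≤ N) {β γ : ℝ} (hγ1 : 19/20 ≤ |γ|) (hγN : 3 * |γ| + 2 ≤ N) (hz : riemannZeta (β + γ * I) = 0) :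
    35/100 / (13 * (1 / 2 * Real.log N + 29/5) + 16) ≤ 1 - β := by
  by_contra! hlt
  have hβ1 : β < 1 := by
    by_contra! h
    exact riemannZeta_ne_zero_of_one_le_re (s := β + γ * I) (by simpa using h) hz
  have hlogN : 1 ≤ Real.log N := by
    rw [Real.le_log_iff_exp_le (by exact_mod_cast (by omega))]
    have := Real.exp_one_lt_d9
    have : (3 : ℝ) ≤ N := by exact_mod_cast hN
    linarith
  set A := 1 / 2 * Real.log N + 29/5 with hA
  set D := 13 * A + 16 with hD
  have hD0 : 97 ≤ D := by rw [hD, hA]; linarith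
  set u := (4/3) / D with hu
  have hDp : 0 < D := by linarith
  have hu0 : 0 < u := by positivity
  have hu1 : u ≤ 3/200 := by rw [hu, div_le_iff₀ hDp]; linarith
  have hd : 35/100 / D ≤ 4/1000 := by rw [div_le_iff₀ hDp]; linarith
  have hN1 : 1 ≤ N := by omega
  have hσ1 : 1 < 1 + u := by linarith
  have hσ2 : 1 + u ≤ 51/50 := by linarith
  have habs2 : |2 * γ| = 2 * |γ| := by rw [abs_mul]; simp
  have habs3 : |3 * γ| = 3 * |γ| := by rw [abs_mul]; simp
  have t0 := zeta_real_logDeriv hu0 hu1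
  have t1 := logDeriv_upper_zero hN1 hσ1 hσ2 hγ1 (by linarith) hz (by linarith)
  have t2 := logDeriv_upper hN1 hσ1 hσ2 (τ := 2 * γ) (by rw [habs2]; linarith) (by rw [habs2]; linarith)
  have t3 := logDeriv_upper hN1 hσ1 hσ2 (τ := 3 * γ) (by rw [habs3]; linarith) (by rw [habs3]; linarith)
  have tt := trig_ineq hσ1 γ
  set x := 1 + u - β with hx
  have hx0 : 0 < x := by linarith
  have hx1 : x ≤ 2/100 := by linarith
  have main : 8 / x ≤ 5 / u + D := by
    have e1 : 8 / x = 8 * (1 / x) := by ring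
    have e2 : 5 / u = 5 * (1 / u) := by ring
    rw [e1, e2, hD]
    linarith
  have e3 : 5 / u = 15/4 * D := by rw [hu]; field_simp; norm_num
  rw [e3, div_le_iff₀ hx0] at main
  have hxD : x < (35/100 + 4/3) / D := by
    have : (35/100 + 4/3) / D = 35/100 / D + u := by rw [hu]; ring
    linarith
  rw [lt_div_iff₀ hDp] at hxD
  nlinarith

end

section

open Complex Filter Topology Set Metric

lemma log_le_quart {L : ℝ} (hL : 32768 ≤ L) : ∃ q : ℝ, 67/5 ≤ q ∧ q ^ 4 = L ∧ Real.log L ≤ 7764/10000 * q := by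
  have hL0 : 0 < L := by linarith
  set q := L ^ (1/4 : ℝ) with hq
  have hq4 : q ^ 4 = L := by
    rw [hq, ← Real.rpow_natCast, ← Real.rpow_mul hL0.le]; norm_num
  have hq0 : 0 < q := Real.rpow_pos_of_pos hL0 _
  have h1 : 67/5 ≤ q := by
    by_contra! h
    have : q ^ 4 < (67/5) ^ 4 := by gcongr
    rw [hq4] at this; norm_num at this; linarith
  refine ⟨q, h1, hq4, ?_⟩
  have h2 : Real.log L = 4 * Real.log q := by rw [← hq4, Real.log_pow]; norm_num
  -- log q ≤ log 13.4 + q/13.4 - 1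
  have h3 : Real.log (q / (67/5)) ≤ q / (67/5) - 1 := Real.log_le_sub_one_of_pos (by positivity)
  rw [Real.log_div hq0.ne' (by norm_num)] at h3
  have h4 : Real.log (67/5) ≤ 26/10 := by
    have h5 : Real.log ((67/5) ^ 4) ≤ Real.log (2 ^ 15) := Real.log_le_log (by norm_num) (by norm_num)
    rw [Real.log_pow, Real.log_pow] at h5
    have := Real.log_two_lt_d9
    push_cast at h5; linarith
  rw [h2]
  linarith

lemma log_lower {L : ℝ} (hL : 32768 ≤ L) : 10397/1000 ≤ Real.log L := by
  have h : Real.log (2 ^ 15) ≤ Real.log L := Real.log_le_log (by norm_num) (by norm_num; linarith)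
  rw [Real.log_pow] at h
  have := Real.log_two_gt_d9
  push_cast at h; linarith

lemma zeta1_zero_free {L : ℝ} (hL : 32768 ≤ L) {s : ℂ} (hs : 1 - 4 * Real.log L / L ≤ s.re) (him : |s.im| ≤ L ^ 2 + 1) :
    riemannZeta₁ s ≠ 0 := by
  obtain ⟨q, hq, hq4, hlq⟩ := log_le_quart hL
  have hl := log_lower hL
  have hL0 : 0 < L := by linarith
  have hη : 4 * Real.log L / L ≤ 1/100 := by
    rw [div_le_iff₀ hL0]
    have : q ^ 4 = q * q ^ 3 := by ring
    have : (67/5) ^ 3 ≤ q ^ 3 := by gcongr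
    nlinarith
  by_cases h1 : 1 ≤ s.re
  · exact zeta1_ne_zero_of_one_le_re h1
  push Not at h1
  by_cases h2 : |s.im| < 19/20
  · apply zeta1_ne_zero_near
    have hn : ‖s - 1‖ ^ 2 < s.re ^ 2 := by
      rw [← normSq_eq_norm_sq, normSq_apply]
      simp only [sub_re, one_re, sub_im, one_im, sub_zero]
      have := sq_lt_sq' (by linarith [abs_nonneg s.im]) h2
      rw [sq_abs] at this
      nlinarith
    exact lt_of_pow_lt_pow_left₀ 2 (by linarith) hn
  push Not at h2
  intro hz
  have hne : s ≠ 1 := by rintro rfl; simp at h1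
  have hz' : riemannZeta s = 0 := by rw [riemannZeta_eq_inv_sub_mul hne, hz, mul_zero]
  set N := ⌈3 * |s.im| + 2⌉₊ with hN
  have hN1 : 3 * |s.im| + 2 ≤ N := Nat.le_ceil _
  have hN2 : (N : ℝ) < 3 * |s.im| + 2 + 1 := Nat.ceil_lt_add_one (by positivity)
  have hN3 : 3 ≤ N := by
    have : (3 : ℝ) ≤ N := by linarith
    exact_mod_cast this
  have hkey := zero_free hN3 h2 hN1 (β := s.re) (γ := s.im) (by rw [re_add_im]; exact hz')
  have hlogN : Real.log N ≤ 2 * Real.log L + 112/100 := by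
    have : (N : ℝ) ≤ L ^ 2 * (1501/500) := by nlinarith
    have h3 : Real.log N ≤ Real.log (L ^ 2 * (1501/500)) := Real.log_le_log (by linarith) this
    rw [Real.log_mul (by positivity) (by norm_num), Real.log_pow] at h3
    have h5 : Real.log ((1501/500) ^ 5) ≤ Real.log (2 ^ 8) := Real.log_le_log (by norm_num) (by norm_num)
    rw [Real.log_pow, Real.log_pow] at h5
    have := Real.log_two_lt_d9
    push_cast at h3 h5; linarith
  set l := Real.log L
  have hNp : 0 ≤ Real.log N := Real.log_natCast_nonneg N
  have hb : 4 * l / L < 35/100 / (13 * (1 / 2 * Real.log N + 29/5) + 16) := by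
    rw [div_lt_div_iff₀ hL0 (by positivity)]
    have : 13 * (1 / 2 * Real.log N + 29/5) + 16 ≤ 13 * l + 99 := by linarith
    have h6 : 4 * l * (13 * (1 / 2 * Real.log N + 29/5) + 16) ≤ 4 * l * (13 * l + 99) := by gcongr
    have h7 : 4 * l * (13 * l + 99) ≤ 4 * (7764/10000 * q) * (13 * (7764/10000 * q) + 99) := by gcongr
    have h8 : 4 * (7764/10000 * q) * (13 * (7764/10000 * q) + 99) < 35/100 * q ^ 4 := by
      have h9 : (67/5) ^ 2 * q ^ 2 ≤ q ^ 4 := by nlinarith [sq_nonneg q]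
      nlinarith
    rw [← hq4]; linarith
  linarith

lemma logDeriv_bound {L : ℝ} (hL : 32768 ≤ L) {s : ℂ} (hs : 1 - 3 * Real.log L / L ≤ s.re) (hs2 : s.re ≤ 1 + 1 / L) (him : |s.im| ≤ L ^ 2) :
    ‖logDeriv riemannZeta₁ s‖ ≤ 360 * L := by
  obtain ⟨q, hq, hq4, hlq⟩ := log_le_quart hL
  have hl := log_lower hL
  have hL0 : 0 < L := by linarith
  set l := Real.log L
  set η := 4 * l / L with hη
  have hη0 : 0 < η := by positivity
  have hη1 : η ≤ 1/100 := by
    rw [hη, div_le_iff₀ hL0, ← hq4]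
    have : q ^ 4 = q * q ^ 3 := by ring
    have : (67/5) ^ 3 ≤ q ^ 3 := by gcongr
    nlinarith
  set s0 : ℂ := ((1 + η : ℝ) : ℂ) + s.im * I with hs0
  have hs0re : s0.re = 1 + η := by simp [hs0]
  have hs0im : s0.im = s.im := by simp [hs0]
  have hzf : ∀ z ∈ ball (0 : ℂ) (2 * η), riemannZeta₁ (s0 + z) ≠ 0 := by
    intro z hz
    rw [mem_ball_zero_iff] at hz
    have h1 := (abs_re_le_norm z).trans hz.le
    have h2 := (abs_im_le_norm z).trans hz.le
    rw [abs_le] at h1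
    apply zeta1_zero_free hL
    · rw [add_re, hs0re]; linarith [h1.1]
    · rw [add_im, hs0im]
      have := abs_add_le s.im z.im
      linarith
  set f : ℂ → ℂ := fun z => riemannZeta₁ (s0 + z) with hf
  have hfd : Differentiable ℂ f := differentiable_riemannZeta₁.comp (by fun_prop)
  have hd : DifferentiableOn ℂ (logDeriv f) (ball 0 (2 * η)) := by
    intro z hz
    have ha : AnalyticAt ℂ f z := hfd.analyticAt z
    exact (ha.deriv.differentiableAt.div ha.differentiableAt (hzf z hz)).differentiableWithinAt
  obtain ⟨h, hh0, hh⟩ := hd.isExactOn_ball.with_val_at 0 0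
  have hexp : ∀ z ∈ ball (0 : ℂ) (2 * η), f z * cexp (-h z) = f 0 := by
    have hder : ∀ z ∈ ball (0 : ℂ) (2 * η), HasDerivAt (fun z => f z * cexp (-h z)) 0 z := by
      intro z hz
      have := (hfd z).hasDerivAt.mul (hh z hz).neg.cexp
      refine this.congr_deriv ?_
      have h2 := hzf z hz
      have h2 : f z ≠ 0 := h2
      rw [logDeriv_apply]; simp only [Pi.neg_apply]; field_simp; ring
    intro z hz
    have h0mem : (0 : ℂ) ∈ ball (0 : ℂ) (2 * η) := by simp; linarith
    have := (convex_ball (0 : ℂ) (2 * η)).is_const_of_fderivWithin_eq_zero (𝕜 := ℂ) (f := fun z => f z * cexp (-h z))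
      (fun z hz => (hder z hz).differentiableAt.differentiableWithinAt)
      (fun z hz => by
        rw [fderivWithin_of_isOpen isOpen_ball hz]
        have := (hder z hz).hasFDerivAt.fderiv
        rw [this]; ext; simp) hz h0mem
    simpa [hh0] using this
  have hf0 : η ^ 2 / 2 ≤ ‖f 0‖ := by
    simp only [hf, add_zero]
    have hne : s0 ≠ 1 := by
      intro h; rw [h] at hs0re; simp at hs0re; linarith
    rw [zeta1_eq_mul hne, norm_mul]
    have h1 : η ≤ ‖s0 - 1‖ := by
      have := (le_abs_self _).trans (abs_re_le_norm (s0 - 1))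
      rw [sub_re, hs0re, one_re] at this; linarith
    have h2 := zeta_inv_norm_le (s := s0) (by rw [hs0re]; linarith)
    rw [hs0re, add_sub_cancel_left] at h2
    have hzp : 0 < ‖riemannZeta s0‖ := norm_pos_iff.mpr (riemannZeta_ne_zero_of_one_lt_re (by rw [hs0re]; linarith))
    have h3 : η / 2 ≤ ‖riemannZeta s0‖ := by
      have h4 : ‖riemannZeta s0‖⁻¹ ≤ (η / 2)⁻¹ := by
        refine h2.trans ?_
        rw [inv_div, show (2:ℝ) / η = 1 / η + 1 / η by ring]
        have : 2 ≤ 1 / η := by rw [le_div_iff₀ hη0]; linarith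
        linarith
      exact (inv_le_inv₀ hzp (by positivity)).mp h4
    calc η ^ 2 / 2 = η * (η / 2) := by ring
      _ ≤ _ := by gcongr
  have hfM : ∀ z ∈ ball (0 : ℂ) (2 * η), ‖f z‖ ≤ 2 * L ^ 4 := by
    intro z hz
    rw [mem_ball_zero_iff] at hz
    have h1 := (abs_re_le_norm z).trans hz.le
    rw [abs_le] at h1
    have hre : 99/100 ≤ (s0 + z).re := by rw [add_re, hs0re]; linarith [h1.1]
    have hn : ‖s0‖ ≤ 1 + η + L ^ 2 := by
      calc ‖s0‖ ≤ ‖((1 + η : ℝ) : ℂ)‖ + ‖(s.im * I : ℂ)‖ := norm_add_le _ _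
        _ = 1 + η + |s.im| := by rw [norm_real, Real.norm_of_nonneg (by linarith), norm_mul, norm_I, mul_one, norm_real, Real.norm_eq_abs]
        _ ≤ _ := by linarith
    have hn1 : ‖s0 + z‖ ≤ L ^ 2 + 2 := by
      have := norm_add_le s0 z; linarith
    have hn2 : ‖s0 + z - 1‖ ≤ L ^ 2 + 3 := by
      have := norm_sub_le (s0 + z) 1; rw [norm_one] at this; linarith
    have h2 := zeta1_norm_le (s := s0 + z) (by linarith)
    have hL2 : 32768 ^ 2 ≤ L ^ 2 := by gcongr
    calc ‖f z‖ ≤ ‖s0 + z‖ * (1 + ‖s0 + z - 1‖ / (s0 + z).re) := h2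
      _ ≤ (L ^ 2 + 2) * (1 + (L ^ 2 + 3) / (99/100)) := by gcongr
      _ ≤ 2 * L ^ 4 := by nlinarith
  set M := 6 * l with hM
  have hMap : MapsTo h (ball 0 (2 * η)) {z | z.re ≤ M} := by
    intro z hz
    have e := hexp z hz
    have hfz : 0 < ‖f z‖ := norm_pos_iff.mpr (hzf z hz)
    have e2 : ‖f 0‖ = ‖f z‖ * Real.exp (-(h z).re) := by rw [← e, norm_mul, norm_exp]; simp
    have e3 : Real.log ‖f 0‖ = Real.log ‖f z‖ - (h z).re := by
      rw [e2, Real.log_mul hfz.ne' (Real.exp_ne_zero _), Real.log_exp]; ring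
    have e4 : Real.log (η ^ 2 / 2) ≤ Real.log ‖f 0‖ := Real.log_le_log (by positivity) hf0
    have e5 : Real.log ‖f z‖ ≤ Real.log (2 * L ^ 4) := Real.log_le_log hfz (hfM z hz)
    have e6 : Real.log (2 * L ^ 4) ≤ Real.log (L ^ 6 * (η ^ 2 / 2)) := by
      apply Real.log_le_log (by positivity)
      have : L ^ 6 * (η ^ 2 / 2) = 8 * l ^ 2 * L ^ 4 := by rw [hη]; field_simp; norm_num
      rw [this]
      have : 2 ≤ 8 * l ^ 2 := by nlinarith
      gcongr
    have e7 : Real.log (L ^ 6 * (η ^ 2 / 2)) = 6 * l + Real.log (η ^ 2 / 2) := by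
      rw [Real.log_mul (by positivity) (by positivity), Real.log_pow]; norm_num; rfl
    show (h z).re ≤ M
    rw [hM]; linarith
  have hhd : DifferentiableOn ℂ h (ball 0 (2 * η)) := fun z hz => (hh z hz).differentiableAt.differentiableWithinAt
  have hM0 : 0 < M := by rw [hM]; linarith
  have hBC : ∀ z : ℂ, ‖z‖ ≤ 15/8 * η → ‖h z‖ ≤ 30 * M := by
    intro z hz
    have hzb : z ∈ ball (0 : ℂ) (2 * η) := by rw [mem_ball_zero_iff]; linarith
    have := borelCaratheodory_zero hM0 hhd hMap (by positivity) hzb hh0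
    refine this.trans ?_
    have h5 : η / 8 ≤ 2 * η - ‖z‖ := by linarith
    rw [div_le_iff₀ (by linarith)]
    have : 0 < M * η := by positivity
    nlinarith
  set z1 : ℂ := s - s0 with hz1
  have hz1n : ‖z1‖ ≤ 7/4 * η := by
    have e : z1 = ((s.re - (1 + η) : ℝ) : ℂ) := by
      apply Complex.ext <;> simp [hz1, hs0]
    rw [e, norm_real, Real.norm_eq_abs, abs_le]
    have e1 : 3 * l / L = 3/4 * η := by rw [hη]; ring
    have e2 : 1 / L ≤ η := by rw [hη]; gcongr; linarith
    constructor <;> linarith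
  have hder : ‖deriv h z1‖ ≤ (30 * M) / (η / 8) := by
    have hsub : closedBall z1 (η / 8) ⊆ ball (0 : ℂ) (2 * η) := by
      intro w hw
      rw [mem_closedBall_iff_norm] at hw
      rw [mem_ball_zero_iff]
      have := norm_add_le (w - z1) z1
      rw [sub_add_cancel] at this; linarith
    apply norm_deriv_le_of_forall_mem_sphere_norm_le (by positivity)
    · exact (hhd.mono hsub).diffContOnCl_ball Subset.rfl
    · intro w hw
      rw [mem_sphere_iff_norm] at hw
      apply hBC
      have := norm_add_le (w - z1) z1
      rw [sub_add_cancel] at this; linarith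
  rw [(hh z1 (by rw [mem_ball_zero_iff]; linarith)).deriv] at hder
  have e : logDeriv f z1 = logDeriv riemannZeta₁ s := by
    rw [logDeriv_apply, logDeriv_apply, hf, deriv_comp_const_add]
    simp [hz1]
  rw [e] at hder
  refine hder.trans (le_of_eq ?_)
  rw [hM, hη]; field_simp; norm_num

end

section

open Complex Filter Topology Set MeasureTheory

noncomputable def gph (d u : ℝ) : ℝ := Real.exp (-(1 / (2 * d)) * u ^ 2) / √(2 * Real.pi * d)

noncomputable def Wg (d w : ℝ) : ℝ := ∫ u in Iic w, gph d u

lemma gph_nonneg (d u : ℝ) : 0 ≤ gph d u := by unfold gph; positivity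

lemma gph_int {d : ℝ} (hd : 0 < d) : Integrable (gph d) :=
  (integrable_exp_neg_mul_sq (b := 1 / (2 * d)) (by positivity)).div_const _

lemma gph_integral {d : ℝ} (hd : 0 < d) : ∫ u, gph d u = 1 := by
  unfold gph
  rw [integral_div, integral_gaussian, show Real.pi / (1 / (2 * d)) = 2 * Real.pi * d by field_simp]
  exact div_self (by positivity)

lemma Wg_nonneg (d w : ℝ) : 0 ≤ Wg d w := integral_nonneg (gph_nonneg d)

lemma Wg_le_one {d : ℝ} (hd : 0 < d) (w : ℝ) : Wg d w ≤ 1 := by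
  rw [← gph_integral hd]
  exact setIntegral_le_integral (gph_int hd) (ae_of_all _ (gph_nonneg d))

lemma gph_shift {d : ℝ} (hd : 0 < d) {w u : ℝ} (h : w * (w + u) ≤ 0) :
    gph d u ≤ Real.exp (-(1 / (2 * d)) * w ^ 2) * gph d (u + w) := by
  unfold gph
  rw [← mul_div_assoc, ← Real.exp_add]
  gcongr
  have : 0 < 1 / (2 * d) := by positivity
  nlinarith

lemma Wg_neg_le {d : ℝ} (hd : 0 < d) {w : ℝ} (hw : 0 ≤ w) : Wg d (-w) ≤ Real.exp (-(1 / (2 * d)) * w ^ 2) := by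
  unfold Wg
  have hi : Integrable (fun u => Real.exp (-(1 / (2 * d)) * w ^ 2) * gph d (u + w)) :=
    ((gph_int hd).comp_add_right w).const_mul _
  calc _ ≤ ∫ u in Iic (-w), Real.exp (-(1 / (2 * d)) * w ^ 2) * gph d (u + w) := by
        apply setIntegral_mono_on (gph_int hd).integrableOn hi.integrableOn measurableSet_Iic
        intro u hu
        apply gph_shift hd
        have : u ≤ -w := hu
        nlinarith
    _ ≤ ∫ u, Real.exp (-(1 / (2 * d)) * w ^ 2) * gph d (u + w) :=
        setIntegral_le_integral hi (ae_of_all _ fun u => mul_nonneg (Real.exp_nonneg _) (gph_nonneg _ _))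
    _ = _ := by rw [integral_const_mul, integral_add_right_eq_self, gph_integral hd, mul_one]

lemma Wg_ge {d : ℝ} (hd : 0 < d) {w : ℝ} (hw : 0 ≤ w) : 1 - Real.exp (-(1 / (2 * d)) * w ^ 2) ≤ Wg d w := by
  have h1 : Wg d w + ∫ u in Ioi w, gph d u = 1 := by
    unfold Wg
    rw [← gph_integral hd, ← integral_add_compl (measurableSet_Iic (a := w)) (gph_int hd), compl_Iic]
  have hi : Integrable (fun u => Real.exp (-(1 / (2 * d)) * (-w) ^ 2) * gph d (u + -w)) :=
    ((gph_int hd).comp_add_right (-w)).const_mul _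
  have h2 : ∫ u in Ioi w, gph d u ≤ Real.exp (-(1 / (2 * d)) * w ^ 2) := by
    calc _ ≤ ∫ u in Ioi w, Real.exp (-(1 / (2 * d)) * (-w) ^ 2) * gph d (u + -w) := by
          apply setIntegral_mono_on (gph_int hd).integrableOn hi.integrableOn measurableSet_Ioi
          intro u hu
          apply gph_shift hd
          have : w < u := hu
          nlinarith
      _ ≤ ∫ u, Real.exp (-(1 / (2 * d)) * (-w) ^ 2) * gph d (u + -w) :=
          setIntegral_le_integral hi (ae_of_all _ fun u => mul_nonneg (Real.exp_nonneg _) (gph_nonneg _ _))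
      _ = _ := by rw [integral_const_mul, integral_add_right_eq_self, gph_integral hd, mul_one, neg_sq]
  linarith

lemma Wg_mono {d : ℝ} (hd : 0 < d) : Monotone (Wg d) := fun _ _ hab =>
  setIntegral_mono_set (gph_int hd).integrableOn (ae_of_all _ (gph_nonneg d)) (Iic_subset_Iic.mpr hab).eventuallyLE

/-- the vertical-line kernel -/
noncomputable def Kg (d w : ℝ) (s : ℂ) : ℂ := cexp (w * s + d / 2 * s ^ 2) / s

lemma norm_cexp_line (d w c t : ℝ) : ‖cexp (w * ((c : ℂ) + t * I) + d / 2 * ((c : ℂ) + t * I) ^ 2)‖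
    = Real.exp (w * c + d / 2 * c ^ 2) * Real.exp (-(d / 2) * t ^ 2) := by
  rw [norm_exp, ← Real.exp_add]
  congr 1
  have e : (w : ℂ) * ((c : ℂ) + t * I) + d / 2 * ((c : ℂ) + t * I) ^ 2 = ((w * c + d / 2 * c ^ 2 - d / 2 * t ^ 2 : ℝ) : ℂ) + ((w * t + d * c * t : ℝ) : ℂ) * I := by
    push_cast; ring_nf; rw [I_sq]; ring
  rw [e, add_re, ofReal_re, re_ofReal_mul, I_re]; ring

lemma line_int {d : ℝ} (hd : 0 < d) (w c : ℝ) : Integrable (fun t : ℝ => cexp (w * ((c : ℂ) + t * I) + d / 2 * ((c : ℂ) + t * I) ^ 2)) := by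
  rw [← integrable_norm_iff (by fun_prop)]
  simp_rw [norm_cexp_line]
  exact (integrable_exp_neg_mul_sq (by positivity)).const_mul _

lemma gph_eq {d : ℝ} (hd : 0 < d) (c u : ℝ) :
    (gph d u : ℂ) = (1 / (2 * Real.pi)) * ∫ t : ℝ, cexp (u * ((c : ℂ) + t * I) + d / 2 * ((c : ℂ) + t * I) ^ 2) := by
  have h := integral_cexp_quadratic (b := ((-(d / 2) : ℝ) : ℂ)) (by simpa using hd) ((u + d * c) * I) (u * c + d / 2 * c ^ 2)
  have e : ∀ t : ℝ, cexp (((-(d / 2) : ℝ) : ℂ) * t ^ 2 + (u + d * c) * I * t + (u * c + d / 2 * c ^ 2)) = cexp (u * ((c : ℂ) + t * I) + d / 2 * ((c : ℂ) + t * I) ^ 2) := by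
    intro t; congr 1; push_cast; ring_nf; rw [I_sq]; ring
  simp_rw [e] at h
  rw [h]
  have hdC : (d : ℂ) ≠ 0 := by exact_mod_cast hd.ne'
  have e2 : (u * c + d / 2 * c ^ 2 - ((u + d * c) * I) ^ 2 / (4 * ((-(d / 2) : ℝ) : ℂ)) : ℂ) = ((-(1 / (2 * d)) * u ^ 2 : ℝ) : ℂ) := by
    push_cast; rw [mul_pow, I_sq]; field_simp; ring
  have e3 : ((Real.pi : ℂ) / -((-(d / 2) : ℝ) : ℂ)) ^ (1 / 2 : ℂ) = ((√(2 * Real.pi / d) : ℝ) : ℂ) := by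
    rw [Real.sqrt_eq_rpow, ofReal_cpow (by positivity)]
    congr 1
    · push_cast; field_simp
    · norm_num
  rw [e2, e3, ← ofReal_exp, gph]
  norm_cast
  have h4 : √(2 * Real.pi / d) = 2 * Real.pi / √(2 * Real.pi * d) := by
    rw [eq_div_iff (by positivity), ← Real.sqrt_mul (by positivity)]
    rw [show 2 * Real.pi / d * (2 * Real.pi * d) = (2 * Real.pi) ^ 2 by field_simp]
    exact Real.sqrt_sq (by positivity)
  rw [h4]
  have := Real.pi_pos
  field_simp

lemma Kg_int {d c : ℝ} (hd : 0 < d) (hc : 0 < c) (w : ℝ) : Integrable (fun t : ℝ => Kg d w ((c : ℂ) + t * I)) := by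
  unfold Kg
  have hne : ∀ t : ℝ, (c : ℂ) + t * I ≠ 0 := fun t h => by
    have := congrArg re h; simp at this; linarith
  refine ((line_int hd w c).norm.const_mul c⁻¹).mono' ?_ (ae_of_all _ fun t => ?_)
  · apply Continuous.aestronglyMeasurable
    exact Continuous.div (by fun_prop) (by fun_prop) hne
  · rw [norm_div, div_eq_inv_mul]
    gcongr
    have := (le_abs_self _).trans (abs_re_le_norm ((c : ℂ) + t * I))
    simpa using this

lemma Wg_eq {d c : ℝ} (hd : 0 < d) (hc : 0 < c) (w : ℝ) :
    (Wg d w : ℂ) = (1 / (2 * Real.pi)) * ∫ t : ℝ, Kg d w ((c : ℂ) + t * I) := by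
  unfold Wg
  rw [← integral_complex_ofReal]
  simp_rw [gph_eq hd c]
  rw [integral_const_mul]
  congr 1
  rw [integral_integral_swap]
  · congr 1; ext t
    have e : ∀ u : ℝ, cexp (u * ((c : ℂ) + t * I) + d / 2 * ((c : ℂ) + t * I) ^ 2) = cexp (((c : ℂ) + t * I) * u) * cexp (d / 2 * ((c : ℂ) + t * I) ^ 2) := by
      intro u; rw [← Complex.exp_add]; congr 1; ring
    simp_rw [e]
    rw [integral_mul_const, integral_exp_mul_complex_Iic (by simpa using hc), Kg, div_mul_eq_mul_div, ← Complex.exp_add]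
    congr 3; ring
  · have h1 := (integrableOn_exp_mul_Iic hc w).mul_prod (integrable_exp_neg_mul_sq (b := d / 2) (by positivity))
    have h2 := h1.const_mul (Real.exp (d / 2 * c ^ 2))
    refine h2.mono' ?_ (ae_of_all _ fun p => ?_)
    · apply Continuous.aestronglyMeasurable
      unfold Function.uncurry; fun_prop
    · simp only [Function.uncurry]
      rw [norm_cexp_line, ← Real.exp_add, ← Real.exp_add, ← Real.exp_add]
      apply le_of_eq; congr 1; ring

end

section

open Complex Filter Topology Set MeasureTheory ArithmeticFunction

lemma line_re (c t : ℝ) : ((c : ℂ) + t * I).re = c := by simp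
lemma line_im (c t : ℝ) : ((c : ℂ) + t * I).im = t := by simp

lemma Kg_shift (d v : ℝ) {n : ℕ} (hn : n ≠ 0) (s : ℂ) :
    Kg d (v - Real.log n) s = (n : ℂ) ^ (-s) * Kg d v s := by
  have hnC : (n : ℂ) ≠ 0 := by exact_mod_cast hn
  have hn0 : (0 : ℝ) ≤ n := by positivity
  unfold Kg
  rw [cpow_def_of_ne_zero hnC, ← mul_div_assoc, ← Complex.exp_add, ← ofReal_natCast, ← ofReal_log hn0]
  congr 2; push_cast; ring

lemma norm_natCast_cpow_line {n : ℕ} (hn : n ≠ 0) (c t : ℝ) : ‖(n : ℂ) ^ (-((c : ℂ) + t * I))‖ = (n : ℝ) ^ (-c) := by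
  rw [norm_natCast_cpow_of_pos (Nat.pos_of_ne_zero hn)]
  simp

lemma vM_summable {c : ℝ} (hc : 1 < c) : Summable (fun n : ℕ => vonMangoldt n * (n : ℝ) ^ (-c)) := by
  have h1 := (LSeriesSummable_vonMangoldt (s := (c : ℂ)) (by simpa using hc)).norm
  convert h1 using 1
  ext n
  by_cases hn : n = 0
  · subst hn; simp
  · rw [LSeries.term_of_ne_zero hn, norm_div, norm_natCast_cpow_of_pos (Nat.pos_of_ne_zero hn), ofReal_re, norm_real, Real.norm_of_nonneg vonMangoldt_nonneg, Real.rpow_neg (by positivity), div_eq_mul_inv]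

lemma vM_hasSum {s : ℂ} (hs : 1 < s.re) : HasSum (fun n : ℕ => (vonMangoldt n : ℂ) * (n : ℂ) ^ (-s)) (-logDeriv riemannZeta s) := by
  have h1 := (LSeriesSummable_vonMangoldt hs).hasSum
  have h2 := LSeries_vonMangoldt_eq_deriv_riemannZeta_div hs
  unfold LSeries at h2
  rw [h2] at h1
  rw [logDeriv_apply, ← neg_div]
  convert h1 using 1
  ext n
  by_cases hn : n = 0
  · subst hn; simp
  · rw [LSeries.term_of_ne_zero hn, div_eq_mul_inv, ← cpow_neg]

lemma vM_real_hasSum {c : ℝ} (hc : 1 < c) : HasSum (fun n : ℕ => vonMangoldt n * (n : ℝ) ^ (-c)) (-(logDeriv riemannZeta (c : ℂ)).re) := by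
  have h := Complex.hasSum_re (vM_hasSum (s := (c : ℂ)) (by simpa using hc))
  rw [neg_re] at h
  convert h using 1
  ext n
  rw [re_ofReal_mul, ← ofReal_natCast, ← ofReal_neg, ← ofReal_cpow (by positivity), ofReal_re]

lemma logDeriv_norm_le {s : ℂ} (hs : 1 < s.re) : ‖logDeriv riemannZeta s‖ ≤ -(logDeriv riemannZeta (s.re : ℂ)).re := by
  rw [← norm_neg, ← (vM_hasSum hs).tsum_eq, ← (vM_real_hasSum hs).tsum_eq]
  have e : ∀ n : ℕ, ‖(vonMangoldt n : ℂ) * (n : ℂ) ^ (-s)‖ = vonMangoldt n * (n : ℝ) ^ (-s.re) := by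
    intro n
    by_cases hn : n = 0
    · subst hn; simp
    · rw [norm_mul, norm_real, Real.norm_of_nonneg vonMangoldt_nonneg, norm_natCast_cpow_of_pos (Nat.pos_of_ne_zero hn), neg_re]
  simp_rw [← e]
  apply norm_tsum_le_tsum_norm
  simp_rw [e]
  exact vM_summable hs

lemma S_hasSum {d c : ℝ} (hd : 0 < d) (hc : 1 < c) (v : ℝ) :
    HasSum (fun n : ℕ => ((vonMangoldt n * Wg d (v - Real.log n) : ℝ) : ℂ))
      ((1 / (2 * Real.pi)) * ∫ t : ℝ, -logDeriv riemannZeta ((c : ℂ) + t * I) * Kg d v ((c : ℂ) + t * I)) := by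
  have hc0 : 0 < c := by linarith
  set F : ℕ → ℝ → ℂ := fun n t => (vonMangoldt n : ℂ) * (n : ℂ) ^ (-((c : ℂ) + t * I)) * Kg d v ((c : ℂ) + t * I) with hF
  have hFe : ∀ n : ℕ, F n = fun t : ℝ => (vonMangoldt n : ℂ) * Kg d (v - Real.log n) ((c : ℂ) + t * I) := by
    intro n; ext t
    by_cases hn : n = 0
    · subst hn; simp [hF]
    · simp only [hF]; rw [Kg_shift d v hn]; ring
  have hi : ∀ n, Integrable (F n) := by
    intro n
    rw [hFe]
    exact (Kg_int hd hc0 _).const_mul _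
  have hnorm : ∀ n : ℕ, (∫ t, ‖F n t‖) = vonMangoldt n * (n : ℝ) ^ (-c) * ∫ t : ℝ, ‖Kg d v ((c : ℂ) + t * I)‖ := by
    intro n
    rw [← integral_const_mul]
    congr 1; ext t
    by_cases hn : n = 0
    · subst hn; simp [hF]
    · simp only [hF]
      rw [norm_mul, norm_mul, norm_natCast_cpow_line hn, norm_real, Real.norm_of_nonneg vonMangoldt_nonneg]
  have hs := hasSum_integral_of_summable_integral_norm hi (by
    simp_rw [hnorm]; exact (vM_summable hc).mul_right _)
  have e1 : ∀ t : ℝ, ∑' n, F n t = -logDeriv riemannZeta ((c : ℂ) + t * I) * Kg d v ((c : ℂ) + t * I) := by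
    intro t
    exact ((vM_hasSum (by rw [line_re]; exact hc)).mul_right _).tsum_eq
  simp_rw [e1] at hs
  have h2 := hs.mul_left (1 / (2 * Real.pi) : ℂ)
  have e3 : (fun n : ℕ => ((vonMangoldt n * Wg d (v - Real.log n) : ℝ) : ℂ)) = fun n => (1 / (2 * Real.pi) : ℂ) * ∫ a, F n a := by
    ext n
    rw [hFe, integral_const_mul, ofReal_mul, Wg_eq hd hc0]
    ring
  rw [e3]; exact h2

lemma main_term {d c : ℝ} (hd : 0 < d) (hc : 1 < c) (v : ℝ) :
    (1 / (2 * Real.pi)) * ∫ t : ℝ, 1 / ((c : ℂ) + t * I - 1) * Kg d v ((c : ℂ) + t * I)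
      = ((Real.exp (v + d / 2) * Wg d (v + d) - Wg d v : ℝ) : ℂ) := by
  have hne : ∀ t : ℝ, (c : ℂ) + t * I ≠ 0 := fun t h => by
    have := congrArg re h; simp at this; linarith
  have hne1 : ∀ t : ℝ, (c : ℂ) + t * I - 1 ≠ 0 := fun t h => by
    have := congrArg re h; simp at this; linarith
  have e : ∀ t : ℝ, 1 / ((c : ℂ) + t * I - 1) * Kg d v ((c : ℂ) + t * I) =
      cexp (v + d / 2) * Kg d (v + d) (((c - 1 : ℝ) : ℂ) + t * I) - Kg d v ((c : ℂ) + t * I) := by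
    intro t
    have e0 : ((c - 1 : ℝ) : ℂ) + t * I = (c : ℂ) + t * I - 1 := by push_cast; ring
    have h1 := hne t
    have h2 := hne1 t
    rw [e0]
    unfold Kg
    generalize (c : ℂ) + t * I = s at *
    rw [← mul_div_assoc (cexp _), ← Complex.exp_add,
      show (v + d / 2 + (((v + d : ℝ) : ℂ) * (s - 1) + d / 2 * (s - 1) ^ 2) : ℂ) = v * s + d / 2 * s ^ 2 by push_cast; ring]
    field_simp
    ring
  simp_rw [e]
  rw [integral_sub ((Kg_int hd (by linarith) _).const_mul _) (Kg_int hd (by linarith) _), integral_const_mul, mul_sub]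
  have e9 : ((Real.exp (v + d / 2) * Wg d (v + d) - Wg d v : ℝ) : ℂ) = cexp (v + d / 2) * (Wg d (v + d) : ℂ) - (Wg d v : ℂ) := by
    push_cast; ring
  rw [e9, Wg_eq hd (c := c) (by linarith) v, Wg_eq hd (c := c - 1) (by linarith) (v + d)]
  ring

lemma G_norm_le {v t : ℝ} (hv : 32768 ≤ v) : ‖logDeriv riemannZeta₁ (((1 + 1 / v : ℝ) : ℂ) + t * I)‖ ≤ 2 * v + 3 := by
  set s : ℂ := ((1 + 1 / v : ℝ) : ℂ) + t * I with hs
  have hv0 : 0 < v := by linarith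
  have hre : s.re = 1 + 1 / v := line_re _ _
  have h0 : 0 < 1 / v := by positivity
  have hs1 : s ≠ 1 := by intro h; rw [h] at hre; simp at hre; linarith
  have h1 := logDeriv_zeta hs1 (zeta1_ne_zero_of_one_le_re (by linarith))
  have h2 := logDeriv_norm_le (s := s) (by linarith)
  rw [hre] at h2
  have h3 := zeta_real_logDeriv h0 (by rw [div_le_iff₀ hv0]; linarith)
  have e : logDeriv riemannZeta₁ s = logDeriv riemannZeta s + 1 / (s - 1) := by rw [h1]; ring
  have h4 : ‖1 / (s - 1)‖ ≤ v := by
    rw [norm_div, norm_one]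
    have := (le_abs_self _).trans (abs_re_le_norm (s - 1))
    rw [sub_re, hre, one_re] at this
    rw [div_le_iff₀ (by linarith)]
    calc 1 = v * (1 / v) := by field_simp
      _ ≤ _ := by gcongr; linarith
  rw [e]
  refine (norm_add_le _ _).trans ?_
  rw [one_div_one_div] at h3
  linarith

end

section

open Complex Filter Topology Set MeasureTheory ArithmeticFunction

lemma Kg_norm (d v c t : ℝ) : ‖Kg d v ((c : ℂ) + t * I)‖ = Real.exp (v * c + d / 2 * c ^ 2) * Real.exp (-(d / 2) * t ^ 2) / ‖(c : ℂ) + t * I‖ := by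
  unfold Kg
  rw [norm_div, norm_cexp_line]

lemma line_norm_ge {c : ℝ} (t : ℝ) : c ≤ ‖(c : ℂ) + t * I‖ := by
  have := (le_abs_self _).trans (abs_re_le_norm ((c : ℂ) + t * I))
  rwa [line_re] at this

lemma line_norm_ge' {c : ℝ} (t : ℝ) : |t| ≤ ‖(c : ℂ) + t * I‖ := by
  have := (abs_im_le_norm ((c : ℂ) + t * I))
  rwa [line_im] at this

noncomputable def gE (v : ℝ) (s : ℂ) : ℂ := -logDeriv riemannZeta₁ s * Kg (1 / v ^ 3) v s

lemma gE_diff {v : ℝ} {s : ℂ} (hs : s ≠ 0) (hz : riemannZeta₁ s ≠ 0) : DifferentiableAt ℂ (gE v) s := by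
  have ha : AnalyticAt ℂ riemannZeta₁ s := differentiable_riemannZeta₁.analyticAt s
  have h1 : DifferentiableAt ℂ (logDeriv riemannZeta₁) s := ha.deriv.differentiableAt.div ha.differentiableAt hz
  have h2 : DifferentiableAt ℂ (Kg (1 / v ^ 3) v) s := by
    unfold Kg
    exact DifferentiableAt.div (by fun_prop) (by fun_prop) hs
  exact h1.neg.mul h2

lemma A_le {v : ℝ} (hv : 32768 ≤ v) : Real.exp (v * (1 + 1 / v) + 1 / v ^ 3 / 2 * (1 + 1 / v) ^ 2) ≤ 3 * Real.exp v := by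
  have hv0 : 0 < v := by linarith
  have h1 : 1 / v ≤ 1 / 32768 := by gcongr
  have h2 : 1 / v ^ 3 ≤ 1 / 32768 ^ 3 := by gcongr
  have h3 : 1 / v ^ 3 / 2 * (1 + 1 / v) ^ 2 ≤ 1 / 32768 ^ 3 / 2 * (1 + 1 / 32768) ^ 2 := by gcongr
  have h4 : v * (1 + 1 / v) = v + 1 := by field_simp
  have h5 : Real.exp (v + 1 + 1/100) = Real.exp v * (Real.exp 1 * Real.exp (1/100)) := by
    rw [← Real.exp_add, ← Real.exp_add]; congr 1; ring
  have h6 : Real.exp (1/100) ≤ 11/10 := by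
    have := Real.exp_bound_div_one_sub_of_interval (x := 1/100) (by norm_num) (by norm_num)
    refine this.trans (by norm_num)
  have h7 := Real.exp_one_lt_d9
  calc _ ≤ Real.exp (v + 1 + 1/100) := by
        apply Real.exp_le_exp.mpr
        rw [h4]
        have : (1 : ℝ) / 32768 ^ 3 / 2 * (1 + 1 / 32768) ^ 2 ≤ 1/100 := by norm_num
        linarith
    _ ≤ 3 * Real.exp v := by
        rw [h5, mul_comm 3]
        gcongr
        nlinarith [Real.exp_pos (1/100)]

lemma gE_int {v : ℝ} (hv : 32768 ≤ v) : Integrable (fun t : ℝ => gE v (((1 + 1 / v : ℝ) : ℂ) + t * I)) := by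
  have hv0 : 0 < v := by linarith
  have hd : 0 < 1 / v ^ 3 := by positivity
  have hc : 0 < 1 + 1 / v := by positivity
  have hi := (Kg_int hd hc v).norm.const_mul (2 * v + 3)
  refine hi.mono' ?_ (ae_of_all _ fun t => ?_)
  · apply Continuous.aestronglyMeasurable
    rw [continuous_iff_continuousAt]
    intro t
    have h1 : ContinuousAt (gE v) (((1 + 1 / v : ℝ) : ℂ) + t * I) := by
      apply (gE_diff _ _).continuousAt
      · intro h; have := congrArg re h; rw [line_re, zero_re] at this; linarith
      · apply zeta1_ne_zero_of_one_le_re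
        rw [line_re]
        have : 0 < 1 / v := by positivity
        linarith
    exact ContinuousAt.comp (f := fun t : ℝ => ((1 + 1 / v : ℝ) : ℂ) + t * I) h1 (by fun_prop)
  · unfold gE
    rw [norm_mul, norm_neg]
    gcongr
    exact G_norm_le hv

lemma exp_small {v : ℝ} (hv : 32768 ≤ v) : v ^ 4 * Real.exp (-(v / 4)) ≤ 1 / 10 ^ 8 := by
  have hv0 : 0 < v := by linarith
  have h := Real.pow_div_factorial_le_exp (v / 4) (by positivity) 8
  rw [Real.exp_neg, ← div_eq_mul_inv, div_le_iff₀ (Real.exp_pos _)]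
  refine le_trans ?_ (mul_le_mul_of_nonneg_left h (by norm_num))
  have h4 : (32768 : ℝ) ^ 4 ≤ v ^ 4 := by gcongr
  have e : (Nat.factorial 8 : ℝ) = 40320 := by norm_num [Nat.factorial]
  rw [e, show 1 / 10 ^ 8 * ((v / 4) ^ 8 / 40320) = v ^ 4 * (v ^ 4 / (10 ^ 8 * 4 ^ 8 * 40320)) by ring]
  apply le_mul_of_one_le_right (by positivity)
  rw [le_div_iff₀ (by positivity)]
  refine le_trans ?_ h4
  norm_num

lemma tail_bound {v : ℝ} (hv : 32768 ≤ v) :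
    ‖∫ t in (Ioc (-v ^ 2) (v ^ 2))ᶜ, gE v (((1 + 1 / v : ℝ) : ℂ) + t * I)‖ ≤ 36 * v ^ 3 * Real.exp (-(v / 4)) * Real.exp v := by
  have hv0 : 0 < v := by linarith
  set d := 1 / v ^ 3 with hd'
  have hd : 0 < d := by positivity
  have hA := A_le hv
  set C := (2 * v + 3) * (3 * Real.exp v) * Real.exp (-(v / 4)) with hC
  have hi : Integrable (fun t : ℝ => C * Real.exp (-(d / 4) * t ^ 2)) := (integrable_exp_neg_mul_sq (by positivity)).const_mul _
  have hb : ∀ t ∈ (Ioc (-v ^ 2) (v ^ 2))ᶜ, ‖gE v (((1 + 1 / v : ℝ) : ℂ) + t * I)‖ ≤ C * Real.exp (-(d / 4) * t ^ 2) := by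
    intro t ht
    have ht2 : v ^ 4 ≤ t ^ 2 := by
      rw [mem_compl_iff, mem_Ioc, not_and_or] at ht
      have h0 : 0 ≤ v ^ 2 := by positivity
      rcases ht with h | h
      · have : v ^ 2 ≤ -t := by linarith
        nlinarith
      · have : v ^ 2 ≤ t := by linarith
        nlinarith
    unfold gE
    rw [norm_mul, norm_neg, Kg_norm]
    have h1 : (1 : ℝ) ≤ ‖((1 + 1 / v : ℝ) : ℂ) + t * I‖ := by
      refine le_trans ?_ (line_norm_ge t)
      have : 0 < 1 / v := by positivity
      linarith
    have h2 : Real.exp (-(d / 2) * t ^ 2) ≤ Real.exp (-(v / 4)) * Real.exp (-(d / 4) * t ^ 2) := by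
      rw [← Real.exp_add]
      apply Real.exp_le_exp.mpr
      have : d / 4 * v ^ 4 ≤ d / 4 * t ^ 2 := by gcongr
      have e : d / 4 * v ^ 4 = v / 4 := by rw [hd']; field_simp
      linarith
    calc _ ≤ (2 * v + 3) * (Real.exp (v * (1 + 1 / v) + d / 2 * (1 + 1 / v) ^ 2) * Real.exp (-(d / 2) * t ^ 2)) := by
          gcongr
          · exact G_norm_le hv
          · exact div_le_self (by positivity) h1
      _ ≤ (2 * v + 3) * ((3 * Real.exp v) * (Real.exp (-(v / 4)) * Real.exp (-(d / 4) * t ^ 2))) := by gcongr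
      _ = _ := by rw [hC]; ring
  have h3 : √(Real.pi / (d / 4)) ≤ 4 * v ^ 2 := by
    rw [Real.sqrt_le_left (by positivity)]
    have e : Real.pi / (d / 4) = 4 * Real.pi * v ^ 3 := by rw [hd']; field_simp
    rw [e]
    have := Real.pi_lt_four
    have h5 : 4 * Real.pi * v ^ 3 ≤ 4 * 4 * v ^ 3 := by gcongr
    refine h5.trans ?_
    have : 0 < v ^ 3 := by positivity
    nlinarith
  calc _ ≤ ∫ t in (Ioc (-v ^ 2) (v ^ 2))ᶜ, C * Real.exp (-(d / 4) * t ^ 2) := by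
        apply norm_integral_le_of_norm_le hi.integrableOn
        exact (ae_restrict_iff' measurableSet_Ioc.compl).mpr (ae_of_all _ hb)
    _ ≤ ∫ t, C * Real.exp (-(d / 4) * t ^ 2) := setIntegral_le_integral hi (ae_of_all _ fun t => by simp only [Pi.zero_apply]; positivity)
    _ = C * √(Real.pi / (d / 4)) := by rw [integral_const_mul, integral_gaussian]
    _ ≤ C * (4 * v ^ 2) := by gcongr
    _ ≤ ((3 * v) * (3 * Real.exp v) * Real.exp (-(v / 4))) * (4 * v ^ 2) := by rw [hC]; gcongr; linarith
    _ = _ := by ring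

lemma sigma_ge {v : ℝ} (hv : 32768 ≤ v) : Real.log v / v ≤ 3174 / 10 ^ 7 := by
  have h := Real.log_div_self_antitoneOn (a := 32768) (b := v) (by
    have := Real.exp_one_lt_d9; simp only [mem_Ici]; linarith) (by
    have := Real.exp_one_lt_d9; simp only [mem_Ici]; linarith) hv
  refine h.trans ?_
  simp only
  rw [show (32768 : ℝ) = 2 ^ 15 by norm_num, Real.log_pow, div_le_iff₀ (by norm_num)]
  have := Real.log_two_lt_d9
  push_cast; linarith

lemma horiz_bound {v T : ℝ} (hv : 32768 ≤ v) (hT : |T| = v ^ 2) :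
    ‖∫ x in (1 - 3 * Real.log v / v)..(1 + 1 / v), gE v (x + T * I)‖ ≤ 1080 * v * Real.exp (-(v / 4)) * Real.exp v := by
  have hv0 : 0 < v := by linarith
  have hA := A_le hv
  have hσ := sigma_ge hv
  have e0 : 3 * Real.log v / v = 3 * (Real.log v / v) := by ring
  have hl : 0 ≤ Real.log v / v := div_nonneg (Real.log_nonneg (by linarith)) hv0.le
  have h1v : 1 / v ≤ 1 / 32768 := by gcongr
  have h0v : 0 < 1 / v := by positivity
  rw [e0]
  have hb : ∀ x ∈ uIoc (1 - 3 * (Real.log v / v)) (1 + 1 / v), ‖gE v (x + T * I)‖ ≤ 1080 * v * Real.exp (-(v / 4)) * Real.exp v := by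
    intro x hx
    rw [uIoc_of_le (by linarith)] at hx
    have hx0 : 0 < x := by linarith [hx.1]
    unfold gE
    rw [norm_mul, norm_neg, Kg_norm]
    have h1 : (1 : ℝ) ≤ ‖(x : ℂ) + T * I‖ := by
      refine le_trans ?_ (line_norm_ge' T)
      rw [hT]; nlinarith
    have h2 : Real.exp (-(1 / v ^ 3 / 2) * T ^ 2) ≤ Real.exp (-(v / 4)) := by
      apply Real.exp_le_exp.mpr
      rw [← sq_abs, hT]
      have : -(1 / v ^ 3 / 2) * (v ^ 2) ^ 2 = - v / 2 := by field_simp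
      linarith
    have h3 : ‖logDeriv riemannZeta₁ (x + T * I)‖ ≤ 360 * v := by
      apply logDeriv_bound hv
      · rw [line_re, e0]; exact hx.1.le
      · rw [line_re]; exact hx.2
      · rw [line_im, hT]
    have h4 : Real.exp (v * x + 1 / v ^ 3 / 2 * x ^ 2) ≤ 3 * Real.exp v := by
      refine le_trans ?_ hA
      have := hx.2
      gcongr
    calc _ ≤ (360 * v) * (Real.exp (v * x + 1 / v ^ 3 / 2 * x ^ 2) * Real.exp (-(1 / v ^ 3 / 2) * T ^ 2)) := by
          gcongr
          exact div_le_self (by positivity) h1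
      _ ≤ (360 * v) * ((3 * Real.exp v) * Real.exp (-(v / 4))) := by gcongr
      _ = _ := by ring
  have h := intervalIntegral.norm_integral_le_of_norm_le_const hb
  refine h.trans (mul_le_of_le_one_right (by positivity) ?_)
  rw [abs_of_nonneg (by linarith)]
  linarith

lemma vert_bound {v : ℝ} (hv : 32768 ≤ v) :
    ‖∫ t in (-v ^ 2)..(v ^ 2), gE v (((1 - 3 * Real.log v / v : ℝ) : ℂ) + t * I)‖ ≤ 474/1000 / v * Real.exp v := by
  have hv0 : 0 < v := by linarith
  have hσ := sigma_ge hv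
  have e0 : 3 * Real.log v / v = 3 * (Real.log v / v) := by ring
  have hl : 0 ≤ Real.log v / v := div_nonneg (Real.log_nonneg (by linarith)) hv0.le
  have h1v : 1 / v ≤ 1 / 32768 := by gcongr
  have h0v : 0 < 1 / v := by positivity
  have hd : 1 / v ^ 3 ≤ 1 / 32768 ^ 3 := by gcongr
  have hd0 : 0 < 1 / v ^ 3 := by positivity
  set σ := 1 - 3 * Real.log v / v with hσd
  have hσ1 : 999/1000 ≤ σ := by rw [hσd, e0]; linarith
  have hσ2 : σ ≤ 1 := by rw [hσd, e0]; linarith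
  set B := 360 * v * (Real.exp v / v ^ 3 * (10001/10000)) * (1000/999) with hB
  have hE : Real.exp (v * σ + 1 / v ^ 3 / 2 * σ ^ 2) ≤ Real.exp v / v ^ 3 * (10001/10000) := by
    have e1 : v * σ = v - Real.log (v ^ 3) := by
      rw [Real.log_pow, hσd]; field_simp; push_cast; ring
    rw [Real.exp_add, e1, Real.exp_sub, Real.exp_log (by positivity)]
    gcongr
    have h6 : Real.exp (1/20000) ≤ 10001/10000 := by
      have := Real.exp_bound_div_one_sub_of_interval (x := 1/20000) (by norm_num) (by norm_num)
      refine this.trans (by norm_num)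
    refine le_trans (Real.exp_le_exp.mpr ?_) h6
    have : σ ^ 2 ≤ 1 := by nlinarith
    have : 1 / v ^ 3 / 2 * σ ^ 2 ≤ 1 / v ^ 3 / 2 * 1 := by gcongr
    have : (1:ℝ) / 32768 ^ 3 ≤ 1/20000 := by norm_num
    linarith
  have hb : ∀ t ∈ Ioc (-v ^ 2) (v ^ 2), ‖gE v ((σ : ℂ) + t * I)‖ ≤ B * (√(1 + t ^ 2))⁻¹ := by
    intro t ht
    have ht2 : |t| ≤ v ^ 2 := abs_le.mpr ⟨by linarith [ht.1], ht.2⟩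
    unfold gE
    rw [norm_mul, norm_neg, Kg_norm]
    have h3 : ‖logDeriv riemannZeta₁ (σ + t * I)‖ ≤ 360 * v := by
      apply logDeriv_bound hv
      · rw [line_re]
      · rw [line_re]; linarith
      · rw [line_im]; exact ht2
    have h2 : Real.exp (-(1 / v ^ 3 / 2) * t ^ 2) ≤ 1 := by
      apply Real.exp_le_one_iff.mpr
      have : 0 ≤ (1 / v ^ 3 / 2) * t ^ 2 := by positivity
      linarith
    have h1 : 999/1000 * √(1 + t ^ 2) ≤ ‖(σ : ℂ) + t * I‖ := by
      rw [norm_def, normSq_apply, line_re, line_im]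
      apply Real.le_sqrt_of_sq_le
      rw [mul_pow, Real.sq_sqrt (by positivity)]
      nlinarith [sq_nonneg t]
    have h4 : 0 < √(1 + t ^ 2) := by positivity
    calc _ ≤ (360 * v) * ((Real.exp v / v ^ 3 * (10001/10000)) * 1 / (999/1000 * √(1 + t ^ 2))) := by gcongr
      _ = _ := by rw [hB]; field_simp
  have hintegral : ∫ t in (-v ^ 2)..(v ^ 2), (√(1 + t ^ 2))⁻¹ = 2 * Real.arsinh (v ^ 2) := by
    rw [intervalIntegral.integral_eq_sub_of_hasDerivAt (f := Real.arsinh)]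
    · rw [Real.arsinh_neg]; ring
    · intro t _; exact Real.hasDerivAt_arsinh t
    · apply Continuous.intervalIntegrable
      exact Continuous.inv₀ (by fun_prop) (fun t => by positivity)
  have harc : Real.arsinh (v ^ 2) ≤ 2 * Real.log v + 694/1000 := by
    unfold Real.arsinh
    have h1 : √(1 + (v ^ 2) ^ 2) ≤ 1 + v ^ 2 := by
      rw [Real.sqrt_le_left (by positivity)]; nlinarith [sq_nonneg v]
    have h2 : v ^ 2 + √(1 + (v ^ 2) ^ 2) ≤ v ^ 2 * (2 * (10001/10000)) := by nlinarith
    refine (Real.log_le_log (by positivity) h2).trans ?_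
    rw [Real.log_mul (by positivity) (by norm_num), Real.log_mul (by norm_num) (by norm_num), Real.log_pow]
    have h3 := Real.log_two_lt_d9
    have h4 := Real.log_le_sub_one_of_pos (x := 10001/10000) (by norm_num)
    push_cast; linarith
  have hc : Continuous (fun t : ℝ => B * (√(1 + t ^ 2))⁻¹) :=
    continuous_const.mul (Continuous.inv₀ (by fun_prop) (fun t => by positivity))
  have h := intervalIntegral.norm_integral_le_of_norm_le (μ := volume) (by nlinarith : -v ^ 2 ≤ v ^ 2)
    (ae_of_all _ hb) (hc.intervalIntegrable _ _)
  rw [intervalIntegral.integral_const_mul, hintegral] at h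
  refine h.trans ?_
  have hB0 : 0 ≤ B := by positivity
  calc B * (2 * Real.arsinh (v ^ 2)) ≤ B * (2 * (2 * Real.log v + 694/1000)) := by gcongr
    _ = (720 * (10001/10000) * (1000/999) * (2 * (Real.log v / v) + 694/1000 * (1 / v))) / v * Real.exp v := by
        rw [hB]; field_simp; ring
    _ ≤ _ := by gcongr; linarith

end

section

open Complex Filter Topology Set MeasureTheory ArithmeticFunction

lemma gE_total {v : ℝ} (hv : 32768 ≤ v) :
    ‖∫ t : ℝ, gE v (((1 + 1 / v : ℝ) : ℂ) + t * I)‖ ≤ 475/1000 / v * Real.exp v := by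
  have hv0 : 0 < v := by linarith
  have hσ := sigma_ge hv
  have e0 : 3 * Real.log v / v = 3 * (Real.log v / v) := by ring
  have hl : 0 ≤ Real.log v / v := div_nonneg (Real.log_nonneg (by linarith)) hv0.le
  have h0v : 0 < 1 / v := by positivity
  have h1 := tail_bound hv
  have h2 := horiz_bound hv (T := v ^ 2) (abs_of_nonneg (by positivity))
  have h3 := horiz_bound hv (T := -v ^ 2) (by rw [abs_neg]; exact abs_of_nonneg (by positivity))
  have h4 := vert_bound hv
  have hsplit := integral_add_compl (measurableSet_Ioc (a := -v ^ 2) (b := v ^ 2)) (gE_int hv)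
  have hrect := integral_boundary_rect_eq_zero_of_differentiableOn (gE v)
    (((1 - 3 * Real.log v / v : ℝ) : ℂ) + ((-v ^ 2 : ℝ) : ℂ) * I) (((1 + 1 / v : ℝ) : ℂ) + ((v ^ 2 : ℝ) : ℂ) * I) (by
      intro s hs
      rw [mem_reProdIm, line_re, line_re, line_im, line_im, uIcc_of_le (by rw [e0]; linarith), uIcc_of_le (by nlinarith)] at hs
      obtain ⟨hs1, hs2⟩ := hs
      apply (gE_diff _ _).differentiableWithinAt
      · intro h
        have := hs1.1
        rw [h, zero_re, e0] at this; linarith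
      · apply zeta1_zero_free hv
        · have := hs1.1
          have e1 : 4 * Real.log v / v = 4 * (Real.log v / v) := by ring
          rw [e0] at this; rw [e1]; linarith
        · rw [abs_le]; exact ⟨by linarith [hs2.1], by linarith [hs2.2]⟩)
  rw [line_re, line_re, line_im, line_im] at hrect
  rw [← intervalIntegral.integral_of_le (by nlinarith)] at hsplit
  rw [← hsplit]
  set X1 := ∫ (x : ℝ) in (1 - 3 * Real.log v / v)..(1 + 1 / v), gE v (x + ((-v ^ 2 : ℝ) : ℂ) * I)
  set X2 := ∫ (x : ℝ) in (1 - 3 * Real.log v / v)..(1 + 1 / v), gE v (x + ((v ^ 2 : ℝ) : ℂ) * I)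
  set X3 := ∫ t in (-v ^ 2)..(v ^ 2), gE v (((1 - 3 * Real.log v / v : ℝ) : ℂ) + t * I)
  set X4 := ∫ t in (-v ^ 2)..(v ^ 2), gE v (((1 + 1 / v : ℝ) : ℂ) + t * I)
  set X5 := ∫ t in (Ioc (-v ^ 2) (v ^ 2))ᶜ, gE v (((1 + 1 / v : ℝ) : ℂ) + t * I)
  have e4 : X4 = X3 + I * X1 - I * X2 := by
    simp only [smul_eq_mul] at hrect
    have := congrArg (fun z => -I * z) hrect
    simp only [mul_zero] at this
    linear_combination this + (X4 - X3) * I_sq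
  rw [e4]
  have hn : ‖X3 + I * X1 - I * X2 + X5‖ ≤ ‖X3‖ + ‖X1‖ + ‖X2‖ + ‖X5‖ := by
    refine (norm_add_le _ _).trans ?_
    gcongr
    refine (norm_sub_le _ _).trans ?_
    rw [norm_mul I X2, norm_I, one_mul]
    gcongr
    refine (norm_add_le _ _).trans ?_
    rw [norm_mul I X1, norm_I, one_mul]
  refine hn.trans ?_
  have hs := exp_small hv
  have hE := Real.exp_pos v
  set q := Real.exp (-(v / 4)) with hq
  have hq0 : 0 < q := Real.exp_pos _
  have h5 : 1080 * v * q + 1080 * v * q + 36 * v ^ 3 * q ≤ 1/1000 / v := by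
    rw [le_div_iff₀ hv0]
    have : v ^ 2 * 1 ≤ v ^ 2 * v ^ 2 := by gcongr; nlinarith
    have : v ^ 2 * q ≤ v ^ 4 * q := mul_le_mul_of_nonneg_right (by linarith) hq0.le
    linarith
  calc ‖X3‖ + ‖X1‖ + ‖X2‖ + ‖X5‖ ≤ (474/1000 / v + (1080 * v * q + 1080 * v * q + 36 * v ^ 3 * q)) * Real.exp v := by linarith
    _ ≤ (474/1000 / v + 1/1000 / v) * Real.exp v := by gcongr
    _ = _ := by ring

lemma S_sum {v : ℝ} (hv : 32768 ≤ v) : ∃ S : ℝ, HasSum (fun n : ℕ => vonMangoldt n * Wg (1 / v ^ 3) (v - Real.log n)) S ∧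
    |S - Real.exp v| ≤ 8/100 / v * Real.exp v := by
  have hv0 : 0 < v := by linarith
  have hd : 0 < 1 / v ^ 3 := by positivity
  have h0v : 0 < 1 / v := by positivity
  have hc : 1 < 1 + 1 / v := by linarith
  have hS := S_hasSum hd hc v
  have e1 : ∀ t : ℝ, -logDeriv riemannZeta (((1 + 1 / v : ℝ) : ℂ) + t * I) * Kg (1 / v ^ 3) v (((1 + 1 / v : ℝ) : ℂ) + t * I)
      = 1 / (((1 + 1 / v : ℝ) : ℂ) + t * I - 1) * Kg (1 / v ^ 3) v (((1 + 1 / v : ℝ) : ℂ) + t * I) + gE v (((1 + 1 / v : ℝ) : ℂ) + t * I) := by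
    intro t
    have hne : ((1 + 1 / v : ℝ) : ℂ) + t * I ≠ 1 := by
      intro h; have := congrArg re h; rw [line_re, one_re] at this; linarith
    rw [logDeriv_zeta hne (zeta1_ne_zero_of_one_le_re (by rw [line_re]; linarith)), gE]
    ring
  have hi1 : Integrable (fun t : ℝ => 1 / (((1 + 1 / v : ℝ) : ℂ) + t * I - 1) * Kg (1 / v ^ 3) v (((1 + 1 / v : ℝ) : ℂ) + t * I)) := by
    have hn : ∀ t : ℝ, ((1 + 1 / v : ℝ) : ℂ) + t * I - 1 ≠ 0 := by
      intro t h; have := congrArg re h; rw [sub_re, line_re, one_re, zero_re] at this; linarith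
    refine ((Kg_int hd (c := 1 + 1 / v) (by linarith) v).norm.const_mul v).mono' ?_ (ae_of_all _ fun t => ?_)
    · apply AEStronglyMeasurable.mul
      · apply Continuous.aestronglyMeasurable
        exact Continuous.div (by fun_prop) (by fun_prop) hn
      · exact (Kg_int hd (c := 1 + 1 / v) (by linarith) v).aestronglyMeasurable
    · rw [norm_mul]
      gcongr
      rw [norm_div, norm_one]
      have := (le_abs_self _).trans (abs_re_le_norm (((1 + 1 / v : ℝ) : ℂ) + t * I - 1))
      rw [sub_re, line_re, one_re] at this
      rw [div_le_iff₀ (by linarith)]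
      calc 1 = v * (1 / v) := by field_simp
        _ ≤ _ := by gcongr; linarith
  simp_rw [e1] at hS
  rw [integral_add hi1 (gE_int hv), mul_add, main_term hd hc] at hS
  have hR := Complex.hasSum_re hS
  simp only [ofReal_re, add_re] at hR
  refine ⟨_, hR, ?_⟩
  set E := ∫ t : ℝ, gE v (((1 + 1 / v : ℝ) : ℂ) + t * I) with hEd
  have hE : |((1 / (2 * Real.pi) : ℂ) * E).re| ≤ 757/10000 / v * Real.exp v := by
    refine (abs_re_le_norm _).trans ?_
    rw [norm_mul]
    have h1 : ‖(1 / (2 * Real.pi) : ℂ)‖ = 1 / (2 * Real.pi) := by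
      rw [show (1 / (2 * Real.pi) : ℂ) = ((1 / (2 * Real.pi) : ℝ) : ℂ) by push_cast; ring, norm_real, Real.norm_of_nonneg (by positivity)]
    have h2 : 1 / (2 * Real.pi) ≤ 1 / (2 * 3.14) := by
      have := Real.pi_gt_d2
      gcongr
    rw [h1]
    calc _ ≤ 1 / (2 * 3.14) * (475/1000 / v * Real.exp v) := by gcongr; exact gE_total hv
      _ = (1 / (2 * 3.14) * (475/1000)) / v * Real.exp v := by ring
      _ ≤ _ := by gcongr; norm_num
  set d := 1 / v ^ 3 with hdd
  have hv2 : 1 / v ^ 2 ≤ 1 / 32768 ^ 2 := by gcongr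
  have hdv : d ≤ 1/10000 / v := by
    rw [hdd, show 1 / v ^ 3 = (1 / v ^ 2) / v by field_simp]
    exact div_le_div_of_nonneg_right (hv2.trans (by norm_num)) hv0.le
  have hex : Real.exp (d / 2) ≤ 1 + d := by
    have hd1 : d ≤ 1 := by
      refine hdv.trans ?_
      rw [div_le_iff₀ hv0]; linarith
    have := Real.exp_bound_div_one_sub_of_interval (x := d / 2) (by positivity) (by linarith)
    refine this.trans ?_
    rw [div_le_iff₀ (by linarith)]
    nlinarith
  have hw1 := Wg_le_one hd (v + d)
  have hw2 := Wg_ge hd (w := v + d) (by positivity)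
  have hw3 := Wg_le_one hd v
  have hw4 := Wg_nonneg d v
  have hs := exp_small hv
  have hq : Real.exp (-(v / 4)) ≤ 1/10000 / v := by
    rw [le_div_iff₀ hv0]
    refine le_trans ?_ (hs.trans (by norm_num))
    rw [mul_comm]
    gcongr
    exact le_self_pow₀ (by linarith) (by norm_num)
  have hw5 : Real.exp (-(1 / (2 * d)) * (v + d) ^ 2) ≤ Real.exp (-(v / 4)) := by
    apply Real.exp_le_exp.mpr
    have h1 : 1 / 4 ≤ 1 / (2 * d) := by
      gcongr
      have : d ≤ 1 := by
        refine hdv.trans ?_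
        rw [div_le_iff₀ hv0]; linarith
      linarith
    have h2 : v ≤ (v + d) ^ 2 := by nlinarith
    have h3 : 1 / 4 * v ≤ 1 / (2 * d) * (v + d) ^ 2 := by gcongr
    linarith
  have hev : 1 ≤ 1/10000 / v * Real.exp v := by
    calc (1 : ℝ) = Real.exp (-v) * Real.exp v := by rw [← Real.exp_add]; simp
      _ ≤ Real.exp (-(v / 4)) * Real.exp v := by gcongr; linarith
      _ ≤ _ := by gcongr
  have hme : Real.exp (v + d / 2) = Real.exp v * Real.exp (d / 2) := Real.exp_add _ _
  have hEp := Real.exp_pos v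
  have hdp : 1 ≤ Real.exp (d / 2) := Real.one_le_exp (by positivity)
  set W1 := Wg d (v + d)
  have hu : Real.exp (d / 2) * W1 ≤ 1 + 1/10000 / v := by nlinarith
  have hlw : 1 - 1/10000 / v ≤ Real.exp (d / 2) * W1 := by
    have : 0 ≤ W1 := Wg_nonneg _ _
    nlinarith
  have hu2 : Real.exp v * (Real.exp (d / 2) * W1) ≤ Real.exp v * (1 + 1/10000 / v) := by gcongr
  have hl2 : Real.exp v * (1 - 1/10000 / v) ≤ Real.exp v * (Real.exp (d / 2) * W1) := by gcongr
  rw [hme]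
  rw [abs_le] at hE ⊢
  have e5 : ∀ k : ℝ, k / v * Real.exp v = k * (Real.exp v / v) := fun k => by ring
  have e6 : Real.exp v * (1 + 1/10000 / v) = Real.exp v + 1/10000 * (Real.exp v / v) := by ring
  have e7 : Real.exp v * (1 - 1/10000 / v) = Real.exp v - 1/10000 * (Real.exp v / v) := by ring
  rw [e5] at hE hev ⊢
  rw [e6] at hu2
  rw [e7] at hl2
  have : 0 < Real.exp v / v := by positivity
  constructor <;> nlinarith

end

section

open Complex Filter Topology Set MeasureTheory ArithmeticFunction

lemma exp_small2 {v : ℝ} (hv : 32768 ≤ v) : v ^ 2 * Real.exp (-(v / 401)) ≤ 1 / 10 ^ 5 := by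
  have hv0 : 0 < v := by linarith
  have h := Real.pow_div_factorial_le_exp (v / 401) (by positivity) 12
  rw [Real.exp_neg, ← div_eq_mul_inv, div_le_iff₀ (Real.exp_pos _)]
  refine le_trans ?_ (mul_le_mul_of_nonneg_left h (by norm_num))
  have h4 : (32768 : ℝ) ^ 10 ≤ v ^ 10 := by gcongr
  have e : (Nat.factorial 12 : ℝ) = 479001600 := by norm_num [Nat.factorial]
  rw [e, show 1 / 10 ^ 5 * ((v / 401) ^ 12 / 479001600) = v ^ 2 * (v ^ 10 / (10 ^ 5 * 401 ^ 12 * 479001600)) by ring]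
  apply le_mul_of_one_le_right (by positivity)
  rw [le_div_iff₀ (by positivity)]
  refine le_trans ?_ h4
  norm_num

lemma psi_upper {l : ℝ} (hl : 32769 ≤ l) : Chebyshev.psi (Real.exp l) ≤ Real.exp l * (1 + 2/10 / l) := by
  have hl0 : 0 < l := by linarith
  set a := 1 / (10 * l) with ha
  have ha0 : 0 < a := by positivity
  have ha1 : a ≤ 1 / (10 * 32769) := by rw [ha]; gcongr
  set v := l + a with hv
  have hv1 : 32768 ≤ v := by linarith
  have hv0 : 0 < v := by linarith
  obtain ⟨S, hS, hSb⟩ := S_sum hv1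
  have hd : 0 < 1 / v ^ 3 := by positivity
  set ε := Real.exp (-(v / 401)) with hε
  have hε0 : 0 < ε := Real.exp_pos _
  have hεb := exp_small2 hv1
  have hW : ∀ n ∈ Finset.Ioc 0 ⌊Real.exp l⌋₊, vonMangoldt n * (1 - ε) ≤ vonMangoldt n * Wg (1 / v ^ 3) (v - Real.log n) := by
    intro n hn
    rw [Finset.mem_Ioc] at hn
    apply mul_le_mul_of_nonneg_left _ vonMangoldt_nonneg
    have hn0 : (0 : ℝ) < n := by exact_mod_cast hn.1
    have hnl : Real.log n ≤ l := by
      rw [Real.log_le_iff_le_exp hn0]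
      exact (Nat.le_floor_iff (Real.exp_nonneg _)).mp hn.2
    have h1 : a ≤ v - Real.log n := by linarith
    refine le_trans ?_ ((Wg_ge hd ha0.le).trans (Wg_mono hd h1))
    have : Real.exp (-(1 / (2 * (1 / v ^ 3))) * a ^ 2) ≤ ε := by
      apply Real.exp_le_exp.mpr
      have e : 1 / (2 * (1 / v ^ 3)) * a ^ 2 = v * (v / l) ^ 2 / 200 := by rw [ha]; field_simp; norm_num
      have h2 : 1 ≤ v / l := by rw [le_div_iff₀ hl0]; linarith
      have h3 : 1 ≤ (v / l) ^ 2 := one_le_pow₀ h2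
      have : v * 1 ≤ v * (v / l) ^ 2 := by gcongr
      linarith
    linarith
  have hsum : Chebyshev.psi (Real.exp l) * (1 - ε) ≤ S := by
    unfold Chebyshev.psi
    rw [Finset.sum_mul]
    exact (Finset.sum_le_sum hW).trans (sum_le_hasSum _ (fun n _ => mul_nonneg vonMangoldt_nonneg (Wg_nonneg _ _)) hS)
  have hεl : ε ≤ 1/1000 / l := by
    rw [le_div_iff₀ hl0]
    have : ε * l ≤ v ^ 2 * ε := by rw [mul_comm]; gcongr; nlinarith
    refine this.trans (hεb.trans (by norm_num))
  have hS2 : S ≤ Real.exp v * (1 + 8/100 / l) := by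
    have h1 := (abs_le.mp hSb).2
    have h2 : 8/100 / v ≤ 8/100 / l := by gcongr; linarith
    have h3 := Real.exp_pos v
    nlinarith
  have hev : Real.exp v = Real.exp l * Real.exp a := Real.exp_add _ _
  have hea : Real.exp a ≤ 1 + 1001/10000 / l := by
    have := Real.exp_bound_div_one_sub_of_interval ha0.le (by linarith)
    refine this.trans ?_
    rw [div_le_iff₀ (by linarith), show 1001/10000 / l = 1001/1000 * a by rw [ha]; field_simp; norm_num]
    nlinarith
  set i := 1 / l with hi
  have hi0 : 0 < i := by positivity
  have hi1 : i ≤ 1/32769 := by rw [hi]; gcongr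
  have ei : ∀ k : ℝ, k / l = k * i := fun k => by rw [hi]; ring
  rw [ei] at *
  have hx := Real.exp_pos l
  have hψ : 0 ≤ Chebyshev.psi (Real.exp l) := Chebyshev.psi_nonneg _
  have h5 : Chebyshev.psi (Real.exp l) * (1 - ε) ≤ Real.exp l * ((1 + 1001/10000 * i) * (1 + 8/100 * i)) := by
    refine hsum.trans (hS2.trans ?_)
    rw [hev, mul_assoc]
    gcongr
  have h6 : (1 + 1001/10000 * i) * (1 + 8/100 * i) ≤ (1 + 2/10 * i) * (1 - ε) := by nlinarith
  have h7 : 0 < 1 - ε := by linarith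
  have h8 : Chebyshev.psi (Real.exp l) * (1 - ε) ≤ (Real.exp l * (1 + 2/10 * i)) * (1 - ε) := by
    refine h5.trans ?_
    rw [mul_assoc]; gcongr
  exact le_of_mul_le_mul_right h8 h7

lemma psi_lower {l : ℝ} (hl : 32769 ≤ l) : Real.exp l * (1 - 2/10 / l) ≤ Chebyshev.psi (Real.exp l) := by
  have hl0 : 0 < l := by linarith
  set a := 1 / (10 * l) with ha
  have ha0 : 0 < a := by positivity
  have ha1 : a ≤ 1 / (10 * 32769) := by rw [ha]; gcongr
  set v := l - a with hv
  have hv1 : 32768 ≤ v := by linarith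
  have hv0 : 0 < v := by linarith
  obtain ⟨S, hS, hSb⟩ := S_sum hv1
  have hd : 0 < 1 / v ^ 3 := by positivity
  set ε := Real.exp (-(v / 401)) with hε
  have hε0 : 0 < ε := Real.exp_pos _
  have hεb := exp_small2 hv1
  have h0v : 0 < 1 / v := by positivity
  set c := 1 + 1 / v with hc
  have hc1 : 1 < c := by linarith
  have hc2 : c ≤ 2 := by
    have : 1 / v ≤ 1 := by rw [div_le_iff₀ hv0]; linarith
    linarith
  set s := Finset.Ioc 0 ⌊Real.exp l⌋₊ with hs
  have hvl : v / l ≤ 1 := by rw [div_le_iff₀ hl0]; linarith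
  have hvl2 : 1 - 1/10000 ≤ v / l := by rw [le_div_iff₀ hl0]; linarith
  have hW : ∀ n : ℕ, vonMangoldt n * Wg (1 / v ^ 3) (v - Real.log n) ≤
      (if n ∈ s then vonMangoldt n else 0) + ε * Real.exp (v + 1) * (vonMangoldt n * (n : ℝ) ^ (-c)) := by
    intro n
    have hΛ : 0 ≤ vonMangoldt n := vonMangoldt_nonneg
    split_ifs with hn
    · have h1 := Wg_le_one hd (v - Real.log n)
      have h2 : 0 ≤ ε * Real.exp (v + 1) * (vonMangoldt n * (n : ℝ) ^ (-c)) := by positivity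
      nlinarith
    · by_cases h0 : n = 0
      · subst h0; simp
      have hn0 : (0 : ℝ) < n := by exact_mod_cast Nat.pos_of_ne_zero h0
      have hnl : l < Real.log n := by
        rw [Real.lt_log_iff_exp_lt hn0]
        by_contra! h
        apply hn
        rw [hs, Finset.mem_Ioc]
        exact ⟨Nat.pos_of_ne_zero h0, Nat.le_floor h⟩
      set w := Real.log n - v with hw
      have hwa : a ≤ w := by linarith
      have h1 : Wg (1 / v ^ 3) (v - Real.log n) ≤ Real.exp (-(1 / (2 * (1 / v ^ 3))) * w ^ 2) := by
        rw [show v - Real.log n = -w by rw [hw]; ring]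
        exact Wg_neg_le hd (by linarith)
      have e1 : (n : ℝ) ^ (-c) * Real.exp (v + 1) = Real.exp (-(c * w)) := by
        rw [Real.rpow_def_of_pos hn0, ← Real.exp_add]
        congr 1
        have : c * v = v + 1 := by rw [hc]; field_simp
        rw [hw]; linarith
      have h2 : Real.exp (-(1 / (2 * (1 / v ^ 3))) * w ^ 2) ≤ ε * Real.exp (-(c * w)) := by
        rw [hε, ← Real.exp_add]
        apply Real.exp_le_exp.mpr
        have e2 : 1 / (2 * (1 / v ^ 3)) = v ^ 3 / 2 := by field_simp
        rw [e2]
        have h3 : v ^ 3 / 4 * a ^ 2 ≤ v ^ 3 / 4 * w ^ 2 := by gcongr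
        have hw0 : 0 ≤ w := by linarith
        have h4 : v ^ 3 / 4 * (a * w) ≤ v ^ 3 / 4 * w ^ 2 := by rw [sq]; gcongr
        have e3 : v ^ 3 / 4 * a ^ 2 = v * (v / l) ^ 2 / 400 := by rw [ha]; field_simp; norm_num
        have e4 : v ^ 3 / 4 * (a * w) = (v ^ 2 * (v / l) / 40) * w := by rw [ha]; field_simp; ring
        have h5 : (1 - 1/10000) ^ 2 ≤ (v / l) ^ 2 := by gcongr
        have h6 : v * (1 - 1/10000) ^ 2 ≤ v * (v / l) ^ 2 := by gcongr
        have h7 : c ≤ v ^ 2 * (v / l) / 40 := by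
          have : 32768 ^ 2 * (1 - 1/10000) ≤ v ^ 2 * (v / l) := by gcongr
          linarith
        have h8 : c * w ≤ (v ^ 2 * (v / l) / 40) * w := by gcongr
        linarith
      calc _ ≤ vonMangoldt n * (ε * Real.exp (-(c * w))) := by gcongr; exact h1.trans h2
        _ = _ := by rw [← e1]; ring
  have hsum1 : HasSum (fun n : ℕ => if n ∈ s then vonMangoldt n else 0) (∑ n ∈ s, if n ∈ s then vonMangoldt n else 0) :=
    hasSum_sum_of_ne_finset_zero (fun n hn => by simp [hn])
  have hsum2 := (vM_real_hasSum hc1).mul_left (ε * Real.exp (v + 1))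
  have hle := hasSum_le hW hS (hsum1.add hsum2)
  have e5 : (∑ n ∈ s, if n ∈ s then vonMangoldt n else 0) = Chebyshev.psi (Real.exp l) := by
    unfold Chebyshev.psi
    apply Finset.sum_congr rfl
    intro n hn; simp [hn]
  rw [e5] at hle
  have hz := zeta_real_logDeriv h0v (by rw [div_le_iff₀ hv0]; linarith)
  rw [one_div_one_div] at hz
  have htail : ε * Real.exp (v + 1) * -(logDeriv riemannZeta (c : ℂ)).re ≤ 1/1000 / v * Real.exp v := by
    have h1 : Real.exp (v + 1) ≤ 3 * Real.exp v := by
      rw [Real.exp_add, mul_comm]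
      have := Real.exp_one_lt_d9
      gcongr; linarith
    have h2 : 0 ≤ -(logDeriv riemannZeta (c : ℂ)).re :=
      (vM_real_hasSum hc1).nonneg (fun n => mul_nonneg vonMangoldt_nonneg (by positivity))
    have h3 : -(logDeriv riemannZeta (c : ℂ)).re ≤ 2 * v := by linarith
    calc _ ≤ ε * (3 * Real.exp v) * (2 * v) := by gcongr
      _ = 6 * (v ^ 2 * ε) / v * Real.exp v := by field_simp; norm_num
      _ ≤ _ := by gcongr; linarith
  have hS1 := (abs_le.mp hSb).1
  have hv2 : 1 / v ≤ 1001/1000 * (1 / l) := by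
    rw [mul_one_div, div_le_div_iff₀ hv0 hl0]; linarith
  set i := 1 / l with hi
  have hi0 : 0 < i := by positivity
  have hi1 : i ≤ 1/32769 := by rw [hi]; gcongr
  have ei : ∀ k : ℝ, k / l = k * i := fun k => by rw [hi]; ring
  have eiv : ∀ k : ℝ, k / v = k * (1 / v) := fun k => by ring
  rw [ei]
  rw [eiv] at htail hS1
  have hE := Real.exp_pos v
  have h9 : Real.exp v * (1 - 82/1000 * i) ≤ Chebyshev.psi (Real.exp l) := by nlinarith
  have hev : Real.exp v = Real.exp l * Real.exp (-a) := by rw [← Real.exp_add]; congr 1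
  have hea : 1 - 1/10 * i ≤ Real.exp (-a) := by
    have := Real.add_one_le_exp (-a)
    have e : a = 1/10 * i := by rw [ha, hi]; field_simp
    linarith
  refine le_trans ?_ h9
  rw [hev, mul_assoc]
  gcongr
  nlinarith

end

section

open Filter Topology Set MeasureTheory

lemma exp_big {v : ℝ} (hv : 32768 ≤ v) : 10 ^ 8 * v ^ 4 ≤ Real.exp (v / 4) := by
  have h := exp_small hv
  have hp := Real.exp_pos (v / 4)
  rw [Real.exp_neg, ← div_eq_mul_inv, div_le_iff₀ hp] at h
  linarith

lemma theta_upper {x : ℝ} (hx0 : 0 < x) (hx : 32769 ≤ Real.log x) : Chebyshev.theta x ≤ x * (1 + 2/10 / Real.log x) := by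
  have h := psi_upper hx
  rw [Real.exp_log hx0] at h
  exact (Chebyshev.theta_le_psi x).trans h

lemma theta_lower {x : ℝ} (hx0 : 0 < x) (hx : 32769 ≤ Real.log x) : x * (1 - 201/1000 / Real.log x) ≤ Chebyshev.theta x := by
  have h := psi_lower hx
  rw [Real.exp_log hx0] at h
  set l := Real.log x with hl
  have hl0 : 0 < l := by linarith
  have hx1 : 1 ≤ x := by
    rw [← Real.exp_log hx0]; exact Real.one_le_exp hl0.le
  have h2 := Chebyshev.psi_sub_theta_le hx1
  have hb := exp_big (v := l) (by linarith)
  have hsq : Real.exp (l / 4) ≤ √x := by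
    apply Real.le_sqrt_of_sq_le
    rw [← Real.exp_nat_mul]
    refine le_trans (Real.exp_le_exp.mpr ?_) (Real.exp_log hx0).le
    rw [← hl]
    push_cast; linarith
  have h3 : 2 * √x * l ≤ x * (1/1000 / l) := by
    have e : x = √x * √x := (Real.mul_self_sqrt hx0.le).symm
    have h4 : 2 * l ≤ √x * (1/1000 / l) := by
      rw [mul_div_assoc', le_div_iff₀ hl0]
      have h4 : l ^ 2 * 1 ≤ l ^ 2 * l ^ 2 := by gcongr; nlinarith
      nlinarith
    have h5 : √x * (2 * l) ≤ √x * (√x * (1/1000 / l)) := by gcongr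
    calc 2 * √x * l = √x * (2 * l) := by ring
      _ ≤ √x * √x * (1/1000 / l) := by linarith
      _ = _ := by rw [← e]
  have e6 : x * (1 - 201/1000 / l) = x * (1 - 2/10 / l) - x * (1/1000 / l) := by ring
  rw [e6]; linarith

lemma theta_int {a b : ℝ} (ha : 2 ≤ a) (hab : a ≤ b) :
    IntervalIntegrable (fun t => Chebyshev.theta t / (t * Real.log t ^ 2)) volume a b := by
  rw [intervalIntegrable_iff_integrableOn_Icc_of_le hab]
  exact (Chebyshev.integrableOn_theta_div_id_mul_log_sq b).mono_set (Icc_subset_Icc_left ha)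

lemma int_log_sq {x : ℝ} (hx0 : 0 < x) (hx : 32769 ≤ Real.log x) :
    ∫ t in (2:ℝ)..x, 1 / Real.log t ^ 2 ≤ 1003/1000 * (x / Real.log x ^ 2) := by
  set L := Real.log x with hL
  have hL0 : 0 < L := by linarith
  set t0 := Real.exp 1000 with ht0
  have ht02 : 2 ≤ t0 := by
    have := Real.add_one_le_exp 1000
    linarith
  have ht0x : t0 ≤ x := by
    rw [← Real.exp_log hx0]; exact Real.exp_le_exp.mpr (by linarith)
  have hi1 := Chebyshev.intervalIntegrable_one_div_log_sq (a := 2) (b := t0) (by norm_num) (by linarith)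
  have hi2 := Chebyshev.intervalIntegrable_one_div_log_sq (a := t0) (b := x) (by linarith) (by linarith)
  rw [← intervalIntegral.integral_add_adjacent_intervals hi1 hi2]
  have h1 : ∫ t in (2:ℝ)..t0, 1 / Real.log t ^ 2 ≤ 3 * t0 := by
    calc _ ≤ ∫ t in (2:ℝ)..t0, (3 : ℝ) := by
          apply intervalIntegral.integral_mono_on ht02 hi1 (by simp)
          intro t ht
          have h2 : Real.log 2 ≤ Real.log t := Real.log_le_log (by norm_num) ht.1
          have h3 := Real.log_two_gt_d9
          rw [div_le_iff₀ (by apply pow_pos; linarith)]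
          nlinarith
      _ = 3 * (t0 - 2) := by rw [intervalIntegral.integral_const, smul_eq_mul]; ring
      _ ≤ _ := by linarith
  have hder : ∀ t ∈ uIcc t0 x, HasDerivAt (fun t => t / Real.log t ^ 2) (1 / Real.log t ^ 2 - 2 / Real.log t ^ 3) t := by
    intro t ht
    rw [uIcc_of_le ht0x] at ht
    have htp : 0 < t := by linarith [ht.1]
    have hlt : 0 < Real.log t := Real.log_pos (by linarith [ht.1])
    have := (hasDerivAt_id t).div ((Real.hasDerivAt_log htp.ne').pow 2) (pow_ne_zero 2 hlt.ne')
    refine this.congr_deriv ?_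
    simp only [id, Pi.pow_apply]
    field_simp
    ring
  have hci : IntervalIntegrable (fun t => 1 / Real.log t ^ 2 - 2 / Real.log t ^ 3) volume t0 x := by
    apply ContinuousOn.intervalIntegrable
    intro t ht
    rw [uIcc_of_le ht0x] at ht
    have htp : 0 < t := by linarith [ht.1]
    have hlt : 0 < Real.log t := Real.log_pos (by linarith [ht.1])
    have h := Real.continuousAt_log htp.ne'
    apply ContinuousAt.continuousWithinAt
    exact (continuousAt_const.div (h.pow 2) (pow_ne_zero 2 hlt.ne')).sub (continuousAt_const.div (h.pow 3) (pow_ne_zero 3 hlt.ne'))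
  have hF := intervalIntegral.integral_eq_sub_of_hasDerivAt hder hci
  have h2 : ∫ t in t0..x, 1 / Real.log t ^ 2 ≤ 1000/998 * (x / L ^ 2) := by
    calc _ ≤ ∫ t in t0..x, 1000/998 * (1 / Real.log t ^ 2 - 2 / Real.log t ^ 3) := by
          apply intervalIntegral.integral_mono_on ht0x hi2 (hci.const_mul _)
          intro t ht
          have h3 : 1000 ≤ Real.log t := by
            rw [← Real.log_exp 1000]; exact Real.log_le_log (Real.exp_pos _) ht.1
          have hlt : 0 < Real.log t := by linarith
          have e : 1 / Real.log t ^ 2 - 2 / Real.log t ^ 3 = 1 / Real.log t ^ 2 * (1 - 2 / Real.log t) := by field_simp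
          have h4 : 2 / Real.log t ≤ 2 / 1000 := by gcongr
          have h5 : 0 < 1 / Real.log t ^ 2 := by positivity
          rw [e]
          nlinarith
      _ = 1000/998 * (x / L ^ 2 - t0 / Real.log t0 ^ 2) := by rw [intervalIntegral.integral_const_mul, hF]
      _ ≤ _ := by
          have : 0 ≤ t0 / Real.log t0 ^ 2 := by positivity
          linarith
  have h3 : 3 * t0 ≤ 1/10000 * (x / L ^ 2) := by
    have hb := exp_big (v := L) (by linarith)
    have h5 : t0 * Real.exp (L / 4) ≤ x := by
      rw [ht0, ← Real.exp_add, ← Real.exp_log hx0]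
      apply Real.exp_le_exp.mpr; linarith
    have hL4 : L ^ 2 * 1 ≤ L ^ 2 * L ^ 2 := by gcongr; nlinarith
    rw [mul_div_assoc', le_div_iff₀ (by positivity)]
    have ht00 : 0 < t0 := by linarith
    have h6 : t0 * (30000 * L ^ 2) ≤ t0 * Real.exp (L / 4) := by gcongr; nlinarith
    linarith
  have : 0 < x / L ^ 2 := by positivity
  linarith

lemma pi_upper {x : ℝ} (hx0 : 0 < x) (hx : 32769 ≤ Real.log x) :
    (Nat.primeCounting ⌊x⌋₊ : ℝ) ≤ x / Real.log x + 16/10 * (x / Real.log x ^ 2) := by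
  have h1 := int_log_sq hx0 hx
  have h2 := theta_upper hx0 hx
  have hx2 : 2 ≤ x := by
    rw [← Real.exp_log hx0]
    have := Real.add_one_le_exp (Real.log x); linarith
  rw [Chebyshev.primeCounting_eq_theta_div_log_add_integral hx2]
  have hL0 : 0 < Real.log x := by linarith
  have h3 : ∫ t in (2:ℝ)..x, Chebyshev.theta t / (t * Real.log t ^ 2) ≤ Real.log 4 * ∫ t in (2:ℝ)..x, 1 / Real.log t ^ 2 := by
    rw [← intervalIntegral.integral_const_mul]
    apply intervalIntegral.integral_mono_on hx2 (theta_int le_rfl hx2)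
      ((Chebyshev.intervalIntegrable_one_div_log_sq (by norm_num) (by linarith)).const_mul _)
    intro t ht
    have htp : 0 < t := by linarith [ht.1]
    have hlt : 0 < Real.log t := Real.log_pos (by linarith [ht.1])
    have h4 := Chebyshev.theta_le_log4_mul_x htp.le
    calc _ ≤ Real.log 4 * t / (t * Real.log t ^ 2) := by gcongr
      _ = _ := by field_simp
  have h4 : Real.log 4 ≤ 1387/1000 := by
    rw [show (4:ℝ) = 2 ^ 2 by norm_num, Real.log_pow]
    have := Real.log_two_lt_d9
    push_cast; linarith
  set L := Real.log x
  have h5 : Chebyshev.theta x / L ≤ x / L + 2/10 * (x / L ^ 2) := by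
    rw [div_le_iff₀ hL0]
    refine h2.trans (le_of_eq ?_)
    field_simp
  have h6 : 0 < x / L ^ 2 := by positivity
  have hlog4 : 0 ≤ Real.log 4 := Real.log_nonneg (by norm_num)
  have h7 : Real.log 4 * ∫ t in (2:ℝ)..x, 1 / Real.log t ^ 2 ≤ 1387/1000 * (1003/1000 * (x / L ^ 2)) := by
    calc _ ≤ Real.log 4 * (1003/1000 * (x / L ^ 2)) := by gcongr
      _ ≤ _ := by gcongr
  linarith

lemma pi_lower {x : ℝ} (hx0 : 0 < x) (hx : 32771 ≤ Real.log x) :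
    x / Real.log x + 25/100 * (x / Real.log x ^ 2) ≤ (Nat.primeCounting ⌊x⌋₊ : ℝ) := by
  have h2 := theta_lower hx0 (by linarith)
  have hx4 : 4 ≤ x := by
    rw [← Real.exp_log hx0]
    have := Real.add_one_le_exp (Real.log x); linarith
  rw [Chebyshev.primeCounting_eq_theta_div_log_add_integral (by linarith)]
  have hL0 : 0 < Real.log x := by linarith
  rw [← intervalIntegral.integral_add_adjacent_intervals (theta_int le_rfl (by linarith : 2 ≤ x / 2)) (theta_int (by linarith : 2 ≤ x / 2) (by linarith))]
  have h3 : 0 ≤ ∫ t in (2:ℝ)..(x / 2), Chebyshev.theta t / (t * Real.log t ^ 2) := by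
    apply intervalIntegral.integral_nonneg (by linarith)
    intro t ht
    have htp : 0 < t := by linarith [ht.1]
    have := Chebyshev.theta_nonneg t
    positivity
  have h4 : 49/100 * (x / Real.log x ^ 2) ≤ ∫ t in (x / 2)..x, Chebyshev.theta t / (t * Real.log t ^ 2) := by
    calc 49/100 * (x / Real.log x ^ 2) = ∫ t in (x / 2)..x, 98/100 / Real.log x ^ 2 := by
          rw [intervalIntegral.integral_const, smul_eq_mul]; ring
      _ ≤ _ := by
          apply intervalIntegral.integral_mono_on (by linarith) (by simp) (theta_int (by linarith) (by linarith))
          intro t ht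
          have htp : 0 < t := by linarith [ht.1]
          have hlt : 32769 ≤ Real.log t := by
            have h5 : Real.log (x / 2) ≤ Real.log t := Real.log_le_log (by linarith) ht.1
            rw [Real.log_div hx0.ne' (by norm_num)] at h5
            have := Real.log_two_lt_d9
            linarith
          have hlt0 : 0 < Real.log t := by linarith
          have h6 := theta_lower htp hlt
          have h7 : Real.log t ≤ Real.log x := Real.log_le_log htp ht.2
          have h8 : 201/1000 / Real.log t ≤ 2/100 := by rw [div_le_iff₀ hlt0]; linarith
          have h9 : t * (98/100) ≤ Chebyshev.theta t := by nlinarith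
          calc 98/100 / Real.log x ^ 2 ≤ 98/100 / Real.log t ^ 2 := by gcongr
            _ = t * (98/100) / (t * Real.log t ^ 2) := by field_simp
            _ ≤ _ := by gcongr
  set L := Real.log x
  have h5 : x / L - 201/1000 * (x / L ^ 2) ≤ Chebyshev.theta x / L := by
    rw [le_div_iff₀ hL0]
    refine le_trans (le_of_eq ?_) h2
    field_simp
  have h6 : 0 < x / L ^ 2 := by positivity
  linarith

lemma omega_le {N : ℕ} (hN : N ≠ 0) : (N.primeFactors.card : ℝ) ≤ 2 * Real.log N := by
  have h1 : 2 ^ N.primeFactors.card ≤ N := by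
    calc 2 ^ N.primeFactors.card ≤ ∏ p ∈ N.primeFactors, p :=
          Finset.pow_card_le_prod _ _ _ (fun p hp => (Nat.prime_of_mem_primeFactors hp).two_le)
      _ ≤ N := Nat.le_of_dvd (Nat.pos_of_ne_zero hN) (Nat.prod_primeFactors_dvd N)
  have h2 : ((2 : ℝ) ^ N.primeFactors.card) ≤ N := by exact_mod_cast h1
  have h3 := Real.log_le_log (by positivity) h2
  rw [Real.log_pow] at h3
  have := Real.log_two_gt_d9
  have h0 : (0 : ℝ) ≤ N.primeFactors.card := by positivity
  nlinarith

lemma exp_104 : 32850 ≤ Real.exp 10.4 := by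
  have h1 := Real.exp_one_gt_d9
  have h2 := Real.pow_div_factorial_le_exp
  have h3 : Real.exp 10.4 = Real.exp 1 ^ 10 * Real.exp 0.4 := by
    rw [← Real.exp_nat_mul, ← Real.exp_add]; norm_num
  have h4 := Real.sum_le_exp_of_nonneg (x := 0.4) (by norm_num) 6
  have h5 : (2.71828 : ℝ) ^ 10 ≤ Real.exp 1 ^ 10 := by gcongr; linarith
  have h6 : (1.4918 : ℝ) ≤ Real.exp 0.4 := by
    refine le_trans ?_ h4
    norm_num [Finset.sum_range_succ, Nat.factorial]
  rw [h3]
  calc (32850 : ℝ) ≤ 2.71828 ^ 10 * 1.4918 := by norm_num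
    _ ≤ _ := by gcongr

lemma logN_ge (N : ℕ) (hN : 10.4 ≤ Real.log (Real.log ((N : ℝ) / (Real.log N) ^ 5))) : 2 ≤ N ∧ 32850 ≤ Real.log N := by
  have hN2 : 2 ≤ N := by
    by_contra! h
    have : N = 0 ∨ N = 1 := by omega
    rcases this with rfl | rfl <;> norm_num at hN
  refine ⟨hN2, ?_⟩
  have hN2' : (2 : ℝ) ≤ N := by exact_mod_cast hN2
  have hN0 : (0 : ℝ) < N := by linarith
  set L := Real.log N with hL
  have hL0 : 0 < L := Real.log_pos (by linarith)
  have e1 : Real.log (N / L ^ 5) = L - 5 * Real.log L := by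
    rw [Real.log_div hN0.ne' (by positivity), Real.log_pow]; push_cast; rfl
  rw [e1] at hN
  set y := L - 5 * Real.log L with hy
  have hy0 : y ≠ 0 := by
    rintro h; rw [h] at hN; norm_num at hN
  rw [← Real.log_abs, Real.le_log_iff_exp_le (abs_pos.mpr hy0)] at hN
  have h1 := exp_104.trans hN
  have h2 : Real.log L ≤ L / 10 - 1 + 3 := by
    have h3 := Real.log_le_sub_one_of_pos (x := L / 10) (by positivity)
    rw [Real.log_div hL0.ne' (by norm_num)] at h3
    have h4 : Real.log 10 ≤ Real.log (2 ^ 4) := Real.log_le_log (by norm_num) (by norm_num)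
    rw [Real.log_pow] at h4
    have := Real.log_two_lt_d9
    push_cast at h4; linarith
  have h3 : -100 ≤ y := by linarith
  have h4 : 32850 ≤ y := by
    rcases le_abs.mp h1 with h | h
    · exact h
    · linarith
  by_contra! h5
  by_cases h6 : 1 ≤ L
  · have := Real.log_nonneg h6
    linarith
  · push Not at h6
    -- log L ≥ log (log 2) 
    have h7 := Real.log_two_gt_d9
    have h8 : 1/2 ≤ L := by
      have := Real.log_le_log (by norm_num) hN2'
      linarith
    have h9 := Real.log_le_log (by norm_num) h8
    rw [one_div, Real.log_inv] at h9
    have := Real.log_two_lt_d9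
    linarith

end

open Real

/-- Equation (5.16) of Lemma 5.8: if `log log (N / (log N)⁵) ≥ 10.4` then
`N / log N < π(N) - ω(N) < 1.00005 · N / log N`. -/
theorem pi_minus_omega_bounds (N : ℕ)
    (hN : 10.4 ≤ Real.log (Real.log ((N : ℝ) / (Real.log N) ^ 5))) :
    (N : ℝ) / Real.log N < (Nat.primeCounting N : ℝ) - (N.primeFactors.card : ℝ) ∧
      (Nat.primeCounting N : ℝ) - (N.primeFactors.card : ℝ) <
        1.00005 * ((N : ℝ) / Real.log N) := by
  obtain ⟨hN2, hL⟩ := logN_ge N hN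
  have hN0 : (0 : ℝ) < N := by exact_mod_cast (by omega : 0 < N)
  have h1 := pi_upper hN0 (by linarith)
  have h2 := pi_lower hN0 (by linarith)
  rw [Nat.floor_natCast] at h1 h2
  have h3 := omega_le (N := N) (by omega)
  have h0 : (0 : ℝ) ≤ N.primeFactors.card := by positivity
  set L := Real.log N with hLd
  have hL0 : 0 < L := by linarith
  have hxL : 0 < (N : ℝ) / L := by positivity
  have hxL2 : 0 < (N : ℝ) / L ^ 2 := by positivity
  constructor
  · have hb := exp_big (v := L) (by linarith)
    have hx : Real.exp (L / 4) ≤ N := by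
      rw [← Real.exp_log hN0]; apply Real.exp_le_exp.mpr; rw [← hLd]; linarith
    have h4 : 2 * L < 25/100 * (N / L ^ 2) := by
      rw [mul_div_assoc', lt_div_iff₀ (by positivity)]
      have : L ^ 3 * 1 ≤ L ^ 3 * L := by gcongr; linarith
      have h5 : 0 < L ^ 3 := by positivity
      nlinarith
    linarith
  · have e : (N : ℝ) / L ^ 2 = (N / L) * (1 / L) := by field_simp
    have h5 : 1 / L ≤ 1 / 32850 := by gcongr
    have h6 : (N : ℝ) / L ^ 2 ≤ (N / L) * (1 / 32850) := by rw [e]; gcongr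
    norm_num at h6 ⊢
    linarith
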